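/- Let p be a prime with p > 5. If PSL(2,p) does not satisfy the replacement property, then there exists a witness to failure for PSL(2,p) of order 2. -/

import Mathlib

section Defs

variable {G : Type*} [Group G]

/-- `g` is a generating sequence of `G`: the set of its entries generates `G`. -/
def IsGenSeq {n : ℕ} (g : Fin n → G) : Prop :=
  Subgroup.closure (Set.range g) = ⊤

/-- `g` is irredundant: for each `i`, the entries other than `g i` do not generate `G`. -/
def IsIrred {n : ℕ} (g : Fin n → G) : Prop :=
  ∀ i : Fin n, Subgroup.closure (g '' {j | j ≠ i}) ≠ ⊤

/-- `m(G)`: the largest length of an irredundant generating sequence of `G`. -/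
noncomputable def maxIrredLen (G : Type*) [Group G] : ℕ :=
  sSup {n | ∃ g : Fin n → G, IsGenSeq g ∧ IsIrred g}

/-- `G` satisfies the replacement property. -/
def ReplacementProperty (G : Type*) [Group G] : Prop :=
  ∀ g : Fin (maxIrredLen G) → G, IsGenSeq g → IsIrred g →
    ∀ x : G, x ≠ 1 → ∃ i, IsGenSeq (Function.update g i x)

/-- `x` is a witness to failure of the replacement property for `G`. -/
def IsWitnessToFailure {G : Type*} [Group G] (x : G) : Prop :=
  x ≠ 1 ∧ ∃ g : Fin (maxIrredLen G) → G, IsGenSeq g ∧ IsIrred g ∧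
    ∀ i, ¬ IsGenSeq (Function.update g i x)

/-- A family of subgroups is in general position. -/
def InGeneralPosition {n : ℕ} (H : Fin n → Subgroup G) : Prop :=
  ∀ j, ¬ ((⨅ i ∈ ({j}ᶜ : Set (Fin n)), H i) ≤ H j)

/-- The sequence of subgroups `M` corresponds to the sequence of elements `g`. -/
def Corresponds {n : ℕ} (M : Fin n → Subgroup G) (g : Fin n → G) : Prop :=
  (∀ i j, j ≠ i → g i ∈ M j) ∧ ∀ i, g i ∉ M i

end Defs

/-- `PSL(2,p)`. -/
abbrev PSL (p : ℕ) : Type := Matrix.ProjectiveSpecialLinearGroup (Fin 2) (ZMod p)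

/-- A conjugation-invariant partition of a group into subgroups `T x` (`x ≠ 1`). -/
structure IsConjPartition {K : Type*} [Group K] (T : K → Subgroup K) : Prop where
  self_mem : ∀ x, x ∈ T x
  eq_of_mem : ∀ x y, x ≠ 1 → y ≠ 1 → y ∈ T x → T y = T x
  conj_mem : ∀ k x y, y ∈ T x → k * y * k⁻¹ ∈ T (k * x * k⁻¹)

/-- A conjugation-invariant partition of a group into subgroups `T x` (`x ≠ 1`), each of which has
index at most two in its normalizer. -/
structure IsToralPartition {K : Type*} [Group K] (T : K → Subgroup K) : Prop
    extends IsConjPartition T where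
  mul_mem_of_not_mem : ∀ x y z, x ≠ 1 → y * x * y⁻¹ ∈ T x → z * x * z⁻¹ ∈ T x →
    y ∉ T x → z ∉ T x → y * z ∈ T x

theorem conj_ne_one {K : Type*} [Group K] {x : K} (hx : x ≠ 1) (k : K) : k * x * k⁻¹ ≠ 1 := by
  simpa using hx

theorem IsConjPartition.mem_normalizer_iff {K : Type*} [Group K] {T : K → Subgroup K}
    (hT : IsConjPartition T) {x y : K} (hx : x ≠ 1) :
    y ∈ Subgroup.normalizer (T x : Set K) ↔ y * x * y⁻¹ ∈ T x := by
  rw [Subgroup.mem_normalizer_iff]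
  refine ⟨fun h => (h x).1 (hT.self_mem x), fun h z => ?_⟩
  have e := hT.eq_of_mem x _ hx (conj_ne_one hx y) h
  refine ⟨fun hz => e ▸ hT.conj_mem y x z hz, fun hz => ?_⟩
  have := hT.conj_mem y⁻¹ _ _ (e.symm ▸ hz)
  simpa [mul_assoc] using this

namespace IsToralPartition

variable {K : Type*} [Group K] {T : K → Subgroup K}

theorem card_normalizer (hT : IsToralPartition T) {x : K} (hx : x ≠ 1) :
    Nat.card (Subgroup.normalizer (T x : Set K)) = Nat.card (T x) ∨
      Nat.card (Subgroup.normalizer (T x : Set K)) = 2 * Nat.card (T x) := by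
  by_cases h : ∃ z ∈ Subgroup.normalizer (T x : Set K), z ∉ T x
  · obtain ⟨z, hzN, hz⟩ := h
    right
    have h2 : (T x).relIndex (Subgroup.normalizer (T x : Set K)) = 2 := by
      rw [Subgroup.relIndex_eq_two_iff]
      refine ⟨z, hzN, fun b hb => ?_⟩
      by_cases hbT : b ∈ T x
      · right
        exact ⟨hbT, fun h => hz (by simpa using (T x).mul_mem ((T x).inv_mem hbT) h)⟩
      · left
        exact ⟨hT.mul_mem_of_not_mem x b z hx ((hT.mem_normalizer_iff hx).1 hb)
          ((hT.mem_normalizer_iff hx).1 hzN) hbT hz, hbT⟩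
    rw [← Subgroup.card_mul_index ((T x).subgroupOf (Subgroup.normalizer (T x : Set K))),
      ← Subgroup.relIndex, h2,
      Nat.card_congr (Subgroup.subgroupOfEquivOfLe Subgroup.le_normalizer).toEquiv, mul_comm]
  · left
    push Not at h
    rw [le_antisymm h Subgroup.le_normalizer]

/-- The nontrivial elements with a conjugate in `T x`. -/
def cls (T : K → Subgroup K) (x : K) : Set K := {y | y ≠ 1 ∧ ∃ k, k * y * k⁻¹ ∈ T x}

theorem card_eq_of_mem_cls (hT : IsToralPartition T) {x y : K} (hx : x ≠ 1) (hy : y ∈ cls T x) :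
    Nat.card (T y) = Nat.card (T x) ∧
      Nat.card (Subgroup.normalizer (T y : Set K)) =
        Nat.card (Subgroup.normalizer (T x : Set K)) := by
  obtain ⟨hy1, k, hk⟩ := hy
  have e := hT.eq_of_mem x _ hx (conj_ne_one hy1 k) hk
  have h1 : ∀ z, z ∈ T y ↔ k * z * k⁻¹ ∈ T x := fun z => by
    rw [← e]
    refine ⟨hT.conj_mem k y z, fun h => ?_⟩
    have := hT.conj_mem k⁻¹ _ _ h
    simpa [mul_assoc] using this
  have h2 : ∀ z, z ∈ Subgroup.normalizer (T y : Set K) ↔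
      k * z * k⁻¹ ∈ Subgroup.normalizer (T x : Set K) := fun z => by
    rw [← e, hT.mem_normalizer_iff hy1, hT.mem_normalizer_iff (conj_ne_one hy1 k), e, h1]
    simp [mul_assoc]
  exact ⟨Nat.card_congr ((MulAut.conj k).toEquiv.subtypeEquiv h1),
    Nat.card_congr ((MulAut.conj k).toEquiv.subtypeEquiv h2)⟩

theorem cls_disjoint (hT : IsToralPartition T) {x y : K} (hx : x ≠ 1) (hy : y ≠ 1)
    (h : y ∉ cls T x) : Disjoint (cls T x) (cls T y) := by
  rw [Set.disjoint_left]
  rintro z ⟨hz, k, hk⟩ ⟨-, l, hl⟩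
  refine h ⟨hy, k * l⁻¹, ?_⟩
  have e := hT.eq_of_mem y _ hy (conj_ne_one hz l) hl
  have e' := hT.eq_of_mem x _ hx (conj_ne_one hz k) hk
  have := hT.conj_mem (k * l⁻¹) _ _ (e.symm ▸ hT.self_mem y)
  rw [← e']
  simpa [mul_assoc] using this

theorem card_cls [Finite K] (hT : IsToralPartition T) {x : K} (hx : x ≠ 1) :
    Nat.card (cls T x) * Nat.card (Subgroup.normalizer (T x : Set K)) =
      Nat.card K * (Nat.card (T x) - 1) := by
  classical
  have key : ∀ y ∈ cls T x, ∃ k, k * y * k⁻¹ ∈ T x := fun y hy => hy.2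
  choose! c hc using key
  have h1 : Nat.card {t : T x // t ≠ 1} = Nat.card (T x) - 1 := by
    have := Fintype.ofFinite (T x)
    rw [Nat.card_eq_fintype_card, Nat.card_eq_fintype_card, Fintype.card_subtype_compl]
    simp
  rw [← h1, ← Nat.card_prod, ← Nat.card_prod]
  refine Nat.card_congr
    { toFun := fun q => (q.2.1 * c q.1.1,
        ⟨⟨(q.2.1 * c q.1.1) * q.1.1 * (q.2.1 * c q.1.1)⁻¹, ?_⟩, ?_⟩)
      invFun := fun q => (⟨q.1⁻¹ * q.2.1.1 * q.1, ?_, ?_⟩,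
        ⟨q.1 * (c (q.1⁻¹ * q.2.1.1 * q.1))⁻¹, ?_⟩)
      left_inv := ?_
      right_inv := ?_ }
  · have := (Subgroup.mem_normalizer_iff.1 q.2.2 _).1 (hc q.1.1 q.1.2)
    simpa [mul_assoc] using this
  · intro h
    exact conj_ne_one q.1.2.1 _ (congrArg Subtype.val h)
  · have : (q.2.1 : K) ≠ 1 := fun h => q.2.2 (Subtype.ext h)
    simpa using conj_ne_one this q.1⁻¹
  · exact ⟨q.1, by simp [mul_assoc]⟩
  · have h1 : (q.2.1 : K) ≠ 1 := fun h => q.2.2 (Subtype.ext h)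
    have hy : q.1⁻¹ * q.2.1.1 * q.1 ∈ cls T x :=
      ⟨by simpa using conj_ne_one h1 q.1⁻¹, q.1, by simp [mul_assoc]⟩
    have h2 := hc _ hy
    set k := c (q.1⁻¹ * q.2.1.1 * q.1)
    have e := hT.eq_of_mem x _ hx h1 q.2.1.2
    have h3 : (q.1 * k⁻¹)⁻¹ ∈ Subgroup.normalizer (T x : Set K) := by
      have h4 : ∀ u, u * q.2.1.1 * u⁻¹ ∈ T x → u ∈ Subgroup.normalizer (T x : Set K) := fun u hu =>
        (congrArg (fun S : Subgroup K => u ∈ Subgroup.normalizer (S : Set K)) e).mp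
          ((hT.mem_normalizer_iff h1).2 (e.symm ▸ hu))
      exact h4 _ (by simpa [mul_assoc] using h2)
    simpa using Subgroup.inv_mem _ h3
  · rintro ⟨⟨y, hy⟩, u, hu⟩
    have : (c y)⁻¹ * (u⁻¹ * (u * (c y * (y * ((c y)⁻¹ * (u⁻¹ * (u * c y))))))) = y := by group
    simp [mul_assoc]
  · rintro ⟨k, ⟨t, ht⟩, ht1⟩
    simp [mul_assoc]

theorem exists_conj_mem_of_card_eq_twelve [Finite K] (hT : IsToralPartition T) {x y : K}
    (hK : Nat.card K = 12) (hx : Nat.card (T x) = 3) (hy : Nat.card (T y) = 3) :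
    ∃ k, k * y * k⁻¹ ∈ T x := by
  have : Fact (Nat.Prime 3) := ⟨Nat.prime_three⟩
  have h12 : (12 : ℕ).factorization 3 = 1 := by
    rw [show 12 = 3 * 4 from rfl, Nat.factorization_mul (by norm_num) (by norm_num)]
    simp [Nat.prime_three.factorization, Nat.factorization_eq_zero_of_not_dvd]
  have h3 : 3 ^ (Nat.card K).factorization 3 = 3 := by rw [hK, h12, pow_one]
  obtain ⟨k, hk⟩ := MulAction.exists_smul_eq K (Sylow.ofCard (T y) (hy.trans h3.symm))
    (Sylow.ofCard (T x) (hx.trans h3.symm))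
  refine ⟨k, ?_⟩
  have h := congrArg (fun S : Sylow 3 K => (S : Subgroup K)) hk
  simp only [Sylow.smul_def, Sylow.pointwise_smul_def, Sylow.coe_ofCard] at h
  rw [← h]
  exact Subgroup.smul_mem_pointwise_smul y (MulAut.conj k) _ (hT.self_mem y)

theorem exists_index_of_class_equation {n a N c : ℕ} (h : a * N = n * (c - 1)) (hc : 2 ≤ c)
    (hN : N = c ∨ N = 2 * c) (hd : N ∣ n) (hn : N < n) :
    ∃ r, 2 ≤ r ∧ ((N = c ∧ a + r = n ∧
        (c = 2 ∧ 2 * r = n ∨ c = 3 ∧ 3 * r = n ∨ 4 ≤ c ∧ 4 * r ≤ n)) ∨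
      (N = 2 * c ∧ 2 * a + 2 * r = n ∧ (c = 2 ∧ 4 * r = n ∨ c = 3 ∧ 6 * r = n ∨ c = 4 ∧ 8 * r = n ∨
        c = 5 ∧ 10 * r = n ∨ 6 ≤ c ∧ 12 * r ≤ n))) := by
  obtain ⟨r, rfl⟩ := hd
  have hN0 : 0 < N := by omega
  have hr : 2 ≤ r := by
    by_contra hr
    have : r ≤ 1 := by omega
    nlinarith
  obtain ⟨d, rfl⟩ : ∃ d, c = d + 1 := ⟨c - 1, by omega⟩
  have ha : a = r * d := by
    apply Nat.eq_of_mul_eq_mul_right hN0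
    rw [h, Nat.add_sub_cancel]; ring
  refine ⟨r, hr, ?_⟩
  subst ha
  rcases hN with rfl | rfl
  · left
    refine ⟨rfl, by ring, ?_⟩
    rcases Nat.lt_or_ge d 3 with h3 | h3
    · interval_cases d <;> omega
    · right; right
      exact ⟨by omega, Nat.mul_le_mul_right r (by omega)⟩
  · right
    refine ⟨rfl, by ring, ?_⟩
    rcases Nat.lt_or_ge d 5 with h3 | h3
    · interval_cases d <;> omega
    · right; right; right; right
      exact ⟨by omega, Nat.mul_le_mul_right r (by omega)⟩

theorem three_classes_of_class_equation {n c₁ c₂ c₃ r₁ r₂ r₃ : ℕ} (hr₁ : 2 ≤ r₁) (hr₂ : 2 ≤ r₂)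
    (hr₃ : 2 ≤ r₃)
    (h₁ : (c₁ = 2 ∧ 4 * r₁ = n ∨ c₁ = 3 ∧ 6 * r₁ = n ∨ c₁ = 4 ∧ 8 * r₁ = n ∨
      c₁ = 5 ∧ 10 * r₁ = n ∨ 6 ≤ c₁ ∧ 12 * r₁ ≤ n))
    (h₂ : (c₂ = 2 ∧ 4 * r₂ = n ∨ c₂ = 3 ∧ 6 * r₂ = n ∨ c₂ = 4 ∧ 8 * r₂ = n ∨
      c₂ = 5 ∧ 10 * r₂ = n ∨ 6 ≤ c₂ ∧ 12 * r₂ ≤ n))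
    (h₃ : (c₃ = 2 ∧ 4 * r₃ = n ∨ c₃ = 3 ∧ 6 * r₃ = n ∨ c₃ = 4 ∧ 8 * r₃ = n ∨
      c₃ = 5 ∧ 10 * r₃ = n ∨ 6 ≤ c₃ ∧ 12 * r₃ ≤ n))
    (hr : 2 * r₁ + 2 * r₂ + 2 * r₃ = n + 2) :
    (n = 12 ∧ ((c₁ = 3 ∧ c₂ = 3) ∨ (c₁ = 3 ∧ c₃ = 3) ∨ (c₂ = 3 ∧ c₃ = 3))) ∨
      (n = 24 ∧ (c₁ = 2 ∨ c₁ = 3 ∨ c₁ = 4) ∧ (c₂ = 2 ∨ c₂ = 3 ∨ c₂ = 4) ∧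
        (c₃ = 2 ∨ c₃ = 3 ∨ c₃ = 4)) ∨
      (n = 60 ∧ (c₁ = 2 ∨ c₁ = 3 ∨ c₁ = 5) ∧ (c₂ = 2 ∨ c₂ = 3 ∨ c₂ = 5) ∧
        (c₃ = 2 ∨ c₃ = 3 ∨ c₃ = 5)) := by
  rcases h₁ with ⟨rfl, h₁⟩ | ⟨rfl, h₁⟩ | ⟨rfl, h₁⟩ | ⟨rfl, h₁⟩ | ⟨-, h₁⟩ <;>
    rcases h₂ with ⟨rfl, h₂⟩ | ⟨rfl, h₂⟩ | ⟨rfl, h₂⟩ | ⟨rfl, h₂⟩ | ⟨-, h₂⟩ <;>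
      rcases h₃ with ⟨rfl, h₃⟩ | ⟨rfl, h₃⟩ | ⟨rfl, h₃⟩ | ⟨rfl, h₃⟩ | ⟨-, h₃⟩ <;>
        first
          | (exfalso; omega)
          | (have hn : n = 12 := (by omega); subst hn; simp)
          | (have hn : n = 24 := (by omega); subst hn; simp)
          | (have hn : n = 60 := (by omega); subst hn; simp)

theorem two_classes_of_class_equation {n a₁ a₂ c₁ c₂ r₁ r₂ N₁ N₂ : ℕ} (hr₁ : 2 ≤ r₁) (hr₂ : 2 ≤ r₂)
    (h₁ : (N₁ = c₁ ∧ a₁ + r₁ = n ∧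
        (c₁ = 2 ∧ 2 * r₁ = n ∨ c₁ = 3 ∧ 3 * r₁ = n ∨ 4 ≤ c₁ ∧ 4 * r₁ ≤ n)) ∨
      (N₁ = 2 * c₁ ∧ 2 * a₁ + 2 * r₁ = n ∧ (c₁ = 2 ∧ 4 * r₁ = n ∨ c₁ = 3 ∧ 6 * r₁ = n ∨
        c₁ = 4 ∧ 8 * r₁ = n ∨ c₁ = 5 ∧ 10 * r₁ = n ∨ 6 ≤ c₁ ∧ 12 * r₁ ≤ n)))
    (h₂ : (N₂ = c₂ ∧ a₂ + r₂ = n ∧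
        (c₂ = 2 ∧ 2 * r₂ = n ∨ c₂ = 3 ∧ 3 * r₂ = n ∨ 4 ≤ c₂ ∧ 4 * r₂ ≤ n)) ∨
      (N₂ = 2 * c₂ ∧ 2 * a₂ + 2 * r₂ = n ∧ (c₂ = 2 ∧ 4 * r₂ = n ∨ c₂ = 3 ∧ 6 * r₂ = n ∨
        c₂ = 4 ∧ 8 * r₂ = n ∨ c₂ = 5 ∧ 10 * r₂ = n ∨ 6 ≤ c₂ ∧ 12 * r₂ ≤ n)))
    (ha : a₁ + a₂ + 1 = n) :
    n = 12 ∧ ((c₁ = 2 ∧ N₁ = 4 ∧ c₂ = 3 ∧ N₂ = 3) ∨ (c₂ = 2 ∧ N₂ = 4 ∧ c₁ = 3 ∧ N₁ = 3)) := by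
  rcases h₁ with ⟨rfl, k₁, h₁⟩ | ⟨rfl, k₁, h₁⟩ <;> rcases h₂ with ⟨rfl, k₂, h₂⟩ | ⟨rfl, k₂, h₂⟩
  · omega
  · rcases h₁ with ⟨rfl, h₁⟩ | ⟨rfl, h₁⟩ | ⟨-, h₁⟩ <;>
      rcases h₂ with ⟨rfl, h₂⟩ | ⟨rfl, h₂⟩ | ⟨rfl, h₂⟩ | ⟨rfl, h₂⟩ | ⟨-, h₂⟩ <;> omega
  · rcases h₁ with ⟨rfl, h₁⟩ | ⟨rfl, h₁⟩ | ⟨rfl, h₁⟩ | ⟨rfl, h₁⟩ | ⟨-, h₁⟩ <;>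
      rcases h₂ with ⟨rfl, h₂⟩ | ⟨rfl, h₂⟩ | ⟨-, h₂⟩ <;> omega
  · omega

/-- A group of order 12 whose tori behave as in `A₄`. -/
def IsTetrahedral (T : K → Subgroup K) : Prop :=
  Nat.card K = 12 ∧ ∀ x, x ≠ 1 →
    (Nat.card (T x) = 2 ∧ Nat.card (Subgroup.normalizer (T x : Set K)) = 4) ∨
    (Nat.card (T x) = 3 ∧ Nat.card (Subgroup.normalizer (T x : Set K)) = 3)

/-- A group of order 24 whose tori behave as in `S₄`. -/
def IsOctahedral (T : K → Subgroup K) : Prop :=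
  Nat.card K = 24 ∧ ∀ x, x ≠ 1 →
    (Nat.card (T x) = 2 ∨ Nat.card (T x) = 3 ∨ Nat.card (T x) = 4) ∧
      Nat.card (Subgroup.normalizer (T x : Set K)) = 2 * Nat.card (T x)

/-- A group of order 60 whose tori behave as in `A₅`. -/
def IsIcosahedral (T : K → Subgroup K) : Prop :=
  Nat.card K = 60 ∧ ∀ x, x ≠ 1 →
    (Nat.card (T x) = 2 ∨ Nat.card (T x) = 3 ∨ Nat.card (T x) = 5) ∧
      Nat.card (Subgroup.normalizer (T x : Set K)) = 2 * Nat.card (T x)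

theorem classification [Finite K] [Nontrivial K] (hT : IsToralPartition T) :
    (∃ x, x ≠ 1 ∧ Subgroup.normalizer (T x : Set K) = ⊤) ∨
      IsTetrahedral T ∨ IsOctahedral T ∨ IsIcosahedral T := by
  by_contra! hcon
  obtain ⟨hN, h12, h24, h60⟩ := hcon
  set n := Nat.card K with hn
  clear_value n
  have hsh : ∀ x : K, x ≠ 1 → _ := fun x hx =>
    exists_index_of_class_equation (n := n) (hn ▸ hT.card_cls hx)
      ((Subgroup.one_lt_card_iff_ne_bot _).2
        (fun h => hx (by simpa [h] using hT.self_mem x)))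
      (hT.card_normalizer hx) (hn ▸ Subgroup.card_subgroup_dvd_card _)
      (hn ▸ lt_of_le_of_ne (Nat.le_of_dvd Nat.card_pos (Subgroup.card_subgroup_dvd_card _))
        (fun h => hN x hx (Subgroup.eq_top_of_card_eq _ h)))
  have hfin : ∀ s : Set K, s.Finite := fun s => s.toFinite
  have hS : Nat.card ({1}ᶜ : Set K) + 1 = n := by
    have := Set.ncard_add_ncard_compl ({1} : Set K)
    rw [Set.ncard_singleton] at this
    rw [hn, Nat.card_coe_set_eq]; omega
  have hsub : ∀ x, cls T x ⊆ ({1}ᶜ : Set K) := fun x y hy => hy.1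
  have hself : ∀ x, x ≠ 1 → x ∈ cls T x := fun x hx => ⟨hx, 1, by simpa using hT.self_mem x⟩
  have hle : ∀ x, x ≠ 1 → n ≤ 4 * Nat.card (cls T x) ∧
      (Nat.card (Subgroup.normalizer (T x : Set K)) = Nat.card (T x) →
        n ≤ 2 * Nat.card (cls T x)) := fun x hx => by
    have h0 : 0 < Nat.card (T x) := Nat.card_pos
    obtain ⟨r, hr, h | h⟩ := hsh x hx <;> omega
  simp only [Nat.card_coe_set_eq] at hS hsh hle
  obtain ⟨x₁, hx₁⟩ := exists_ne (1 : K)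
  have hx₂ : ∃ x₂, x₂ ≠ 1 ∧ x₂ ∉ cls T x₁ := by
    by_contra! h
    have : cls T x₁ = {1}ᶜ := (hsub _).antisymm h
    obtain ⟨r, hr, h⟩ := hsh x₁ hx₁
    rw [this] at h
    omega
  obtain ⟨x₂, hx₂, h₁₂⟩ := hx₂
  have d₁₂ := hT.cls_disjoint hx₁ hx₂ h₁₂
  have u₁₂ := Set.ncard_union_eq d₁₂ (hfin _) (hfin _)
  have hx₃ : ∃ x₃, x₃ ≠ 1 ∧ x₃ ∉ cls T x₁ ∪ cls T x₂ := by
    by_contra! h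
    have : cls T x₁ ∪ cls T x₂ = {1}ᶜ := (Set.union_subset (hsub _) (hsub _)).antisymm h
    rw [this] at u₁₂
    obtain ⟨r₁, hr₁, h₁⟩ := hsh x₁ hx₁
    obtain ⟨r₂, hr₂, h₂⟩ := hsh x₂ hx₂
    have h12' : n = 12 ∧ ((Nat.card (T x₁) = 2 ∧
        Nat.card (Subgroup.normalizer (T x₁ : Set K)) = 4 ∧ Nat.card (T x₂) = 3 ∧
        Nat.card (Subgroup.normalizer (T x₂ : Set K)) = 3) ∨ (Nat.card (T x₂) = 2 ∧
        Nat.card (Subgroup.normalizer (T x₂ : Set K)) = 4 ∧ Nat.card (T x₁) = 3 ∧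
        Nat.card (Subgroup.normalizer (T x₁ : Set K)) = 3)) :=
      two_classes_of_class_equation hr₁ hr₂ h₁ h₂ (by omega)
    refine h12 ⟨hn.symm.trans h12'.1, fun x hx => ?_⟩
    have hx' : x ∈ cls T x₁ ∪ cls T x₂ := this ▸ hx
    rcases hx' with hx' | hx'
    · have e := hT.card_eq_of_mem_cls hx₁ hx'
      omega
    · have e := hT.card_eq_of_mem_cls hx₂ hx'
      omega
  obtain ⟨x₃, hx₃, h₁₂₃⟩ := hx₃
  have h₁₃ : x₃ ∉ cls T x₁ := fun h => h₁₂₃ (Or.inl h)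
  have h₂₃ : x₃ ∉ cls T x₂ := fun h => h₁₂₃ (Or.inr h)
  have d₁₂₃ : Disjoint (cls T x₁ ∪ cls T x₂) (cls T x₃) :=
    Set.disjoint_union_left.2 ⟨hT.cls_disjoint hx₁ hx₃ h₁₃, hT.cls_disjoint hx₂ hx₃ h₂₃⟩
  have u₁₂₃ := Set.ncard_union_eq d₁₂₃ (hfin _) (hfin _)
  have l₁ := hle x₁ hx₁
  have l₂ := hle x₂ hx₂
  have l₃ := hle x₃ hx₃
  have hall : cls T x₁ ∪ cls T x₂ ∪ cls T x₃ = {1}ᶜ := by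
    refine (Set.union_subset (Set.union_subset (hsub _) (hsub _)) (hsub _)).antisymm ?_
    intro x₄ hx₄
    by_contra h
    have hx₄ : x₄ ≠ 1 := hx₄
    have d : Disjoint (cls T x₁ ∪ cls T x₂ ∪ cls T x₃) (cls T x₄) :=
      Set.disjoint_union_left.2 ⟨Set.disjoint_union_left.2
        ⟨hT.cls_disjoint hx₁ hx₄ fun h' => h (Or.inl (Or.inl h')),
          hT.cls_disjoint hx₂ hx₄ fun h' => h (Or.inl (Or.inr h'))⟩,
        hT.cls_disjoint hx₃ hx₄ fun h' => h (Or.inr h')⟩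
    have u := Set.ncard_union_eq d (hfin _) (hfin _)
    have := Set.ncard_le_ncard (Set.union_subset (Set.union_subset
      (Set.union_subset (hsub x₁) (hsub x₂)) (hsub x₃)) (hsub x₄)) (hfin _)
    have l₄ := hle x₄ hx₄
    omega
  rw [hall, u₁₂] at u₁₂₃
  have n₁ := hT.card_normalizer hx₁
  have n₂ := hT.card_normalizer hx₂
  have n₃ := hT.card_normalizer hx₃
  have m₁ : Nat.card (Subgroup.normalizer (T x₁ : Set K)) = 2 * Nat.card (T x₁) := by omega
  have m₂ : Nat.card (Subgroup.normalizer (T x₂ : Set K)) = 2 * Nat.card (T x₂) := by omega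
  have m₃ : Nat.card (Subgroup.normalizer (T x₃ : Set K)) = 2 * Nat.card (T x₃) := by omega
  have p₁ : 0 < Nat.card (T x₁) := Nat.card_pos
  have p₂ : 0 < Nat.card (T x₂) := Nat.card_pos
  have p₃ : 0 < Nat.card (T x₃) := Nat.card_pos
  obtain ⟨r₁, hr₁, h₁ | ⟨-, a₁, h₁⟩⟩ := hsh x₁ hx₁
  · omega
  obtain ⟨r₂, hr₂, h₂ | ⟨-, a₂, h₂⟩⟩ := hsh x₂ hx₂
  · omega
  obtain ⟨r₃, hr₃, h₃ | ⟨-, a₃, h₃⟩⟩ := hsh x₃ hx₃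
  · omega
  have hr : 2 * r₁ + 2 * r₂ + 2 * r₃ = n + 2 := by linarith
  have hcases : (n = 12 ∧ ((Nat.card (T x₁) = 3 ∧ Nat.card (T x₂) = 3) ∨
      (Nat.card (T x₁) = 3 ∧ Nat.card (T x₃) = 3) ∨
      (Nat.card (T x₂) = 3 ∧ Nat.card (T x₃) = 3))) ∨
      (n = 24 ∧ (Nat.card (T x₁) = 2 ∨ Nat.card (T x₁) = 3 ∨ Nat.card (T x₁) = 4) ∧
        (Nat.card (T x₂) = 2 ∨ Nat.card (T x₂) = 3 ∨ Nat.card (T x₂) = 4) ∧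
        (Nat.card (T x₃) = 2 ∨ Nat.card (T x₃) = 3 ∨ Nat.card (T x₃) = 4)) ∨
      (n = 60 ∧ (Nat.card (T x₁) = 2 ∨ Nat.card (T x₁) = 3 ∨ Nat.card (T x₁) = 5) ∧
        (Nat.card (T x₂) = 2 ∨ Nat.card (T x₂) = 3 ∨ Nat.card (T x₂) = 5) ∧
        (Nat.card (T x₃) = 2 ∨ Nat.card (T x₃) = 3 ∨ Nat.card (T x₃) = 5)) :=
    three_classes_of_class_equation hr₁ hr₂ hr₃ h₁ h₂ h₃ hr
  have hmem : ∀ x, x ≠ 1 → x ∈ cls T x₁ ∨ x ∈ cls T x₂ ∨ x ∈ cls T x₃ := fun x hx => by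
    have : x ∈ cls T x₁ ∪ cls T x₂ ∪ cls T x₃ := by rw [hall]; exact hx
    exact or_assoc.1 this
  clear hsh hle l₁ l₂ l₃ n₁ n₂ n₃ h₁ h₂ h₃
  rcases hcases with ⟨h, h' | h' | h'⟩ | h | h
  · exact h₁₂ ⟨hx₂, hT.exists_conj_mem_of_card_eq_twelve (hn.symm.trans h) h'.1 h'.2⟩
  · exact h₁₃ ⟨hx₃, hT.exists_conj_mem_of_card_eq_twelve (hn.symm.trans h) h'.1 h'.2⟩
  · exact h₂₃ ⟨hx₃, hT.exists_conj_mem_of_card_eq_twelve (hn.symm.trans h) h'.1 h'.2⟩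
  · refine h24 ⟨hn.symm.trans h.1, fun x hx => ?_⟩
    rcases hmem x hx with hx' | hx' | hx'
    · have e := hT.card_eq_of_mem_cls hx₁ hx'; omega
    · have e := hT.card_eq_of_mem_cls hx₂ hx'; omega
    · have e := hT.card_eq_of_mem_cls hx₃ hx'; omega
  · refine h60 ⟨hn.symm.trans h.1, fun x hx => ?_⟩
    rcases hmem x hx with hx' | hx' | hx'
    · have e := hT.card_eq_of_mem_cls hx₁ hx'; omega
    · have e := hT.card_eq_of_mem_cls hx₂ hx'; omega
    · have e := hT.card_eq_of_mem_cls hx₃ hx'; omega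

end IsToralPartition

section
open Matrix

namespace SLTwo

variable {F : Type*} [Field F]

local notation "SL₂" => Matrix.SpecialLinearGroup (Fin 2) F

/-- The trace of a matrix in `SL₂`. -/
def tr (A : SL₂) : F := A 0 0 + A 1 1

/-- The matrix is a scalar matrix. -/
def IsScalar (A : SL₂) : Prop := A 0 1 = 0 ∧ A 1 0 = 0 ∧ A 0 0 = A 1 1

theorem mul_00 (A B : SL₂) : (A * B) 0 0 = A 0 0 * B 0 0 + A 0 1 * B 1 0 := by
  simp [Matrix.SpecialLinearGroup.coe_mul, Matrix.mul_apply]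

theorem mul_01 (A B : SL₂) : (A * B) 0 1 = A 0 0 * B 0 1 + A 0 1 * B 1 1 := by
  simp [Matrix.SpecialLinearGroup.coe_mul, Matrix.mul_apply]

theorem mul_10 (A B : SL₂) : (A * B) 1 0 = A 1 0 * B 0 0 + A 1 1 * B 1 0 := by
  simp [Matrix.SpecialLinearGroup.coe_mul, Matrix.mul_apply]

theorem mul_11 (A B : SL₂) : (A * B) 1 1 = A 1 0 * B 0 1 + A 1 1 * B 1 1 := by
  simp [Matrix.SpecialLinearGroup.coe_mul, Matrix.mul_apply]

theorem inv_00 (A : SL₂) : A⁻¹ 0 0 = A 1 1 := by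
  simp [Matrix.SpecialLinearGroup.SL2_inv_expl]

theorem inv_01 (A : SL₂) : A⁻¹ 0 1 = -A 0 1 := by
  simp [Matrix.SpecialLinearGroup.SL2_inv_expl]

theorem inv_10 (A : SL₂) : A⁻¹ 1 0 = -A 1 0 := by
  simp [Matrix.SpecialLinearGroup.SL2_inv_expl]

theorem inv_11 (A : SL₂) : A⁻¹ 1 1 = A 0 0 := by
  simp [Matrix.SpecialLinearGroup.SL2_inv_expl]

theorem det_eq (A : SL₂) : A 0 0 * A 1 1 - A 0 1 * A 1 0 = 1 := by
  rw [← Matrix.det_fin_two]; exact A.2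

theorem ext_entries {A B : SL₂} (h₀₀ : A 0 0 = B 0 0) (h₀₁ : A 0 1 = B 0 1) (h₁₀ : A 1 0 = B 1 0)
    (h₁₁ : A 1 1 = B 1 1) : A = B := by
  ext i j
  fin_cases i <;> fin_cases j <;> assumption

theorem mul_comm_iff (A B : SL₂) : A * B = B * A ↔
    A 0 1 * B 1 0 = A 1 0 * B 0 1 ∧ A 0 1 * (B 0 0 - B 1 1) = B 0 1 * (A 0 0 - A 1 1) ∧
      A 1 0 * (B 0 0 - B 1 1) = B 1 0 * (A 0 0 - A 1 1) := by
  constructor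
  · intro h
    have h₀ := congrArg (fun M : SL₂ => M 0 0) h
    have h₁ := congrArg (fun M : SL₂ => M 0 1) h
    have h₂ := congrArg (fun M : SL₂ => M 1 0) h
    simp only [mul_00, mul_01, mul_10] at h₀ h₁ h₂
    refine ⟨?_, ?_, ?_⟩
    · linear_combination h₀
    · linear_combination -h₁
    · linear_combination h₂
  · rintro ⟨h₀, h₁, h₂⟩
    apply ext_entries <;> simp only [mul_00, mul_01, mul_10, mul_11]
    · linear_combination h₀
    · linear_combination -h₁
    · linear_combination h₂
    · linear_combination -h₀

theorem comm_of_comm {A B C : SL₂} (hA : ¬ IsScalar A) (hB : A * B = B * A) (hC : A * C = C * A) :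
    B * C = C * B := by
  rw [mul_comm_iff] at *
  obtain ⟨b₀, b₁, b₂⟩ := hB
  obtain ⟨c₀, c₁, c₂⟩ := hC
  have key : ∀ x : F, x * (B 0 1 * C 1 0 - B 1 0 * C 0 1) = 0 →
      x * (B 0 1 * (C 0 0 - C 1 1) - C 0 1 * (B 0 0 - B 1 1)) = 0 →
      x * (B 1 0 * (C 0 0 - C 1 1) - C 1 0 * (B 0 0 - B 1 1)) = 0 → x ≠ 0 →
      B 0 1 * C 1 0 = B 1 0 * C 0 1 ∧ B 0 1 * (C 0 0 - C 1 1) = C 0 1 * (B 0 0 - B 1 1) ∧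
      B 1 0 * (C 0 0 - C 1 1) = C 1 0 * (B 0 0 - B 1 1) := fun x h₁ h₂ h₃ hx =>
    ⟨sub_eq_zero.1 ((mul_eq_zero.1 h₁).resolve_left hx),
      sub_eq_zero.1 ((mul_eq_zero.1 h₂).resolve_left hx),
      sub_eq_zero.1 ((mul_eq_zero.1 h₃).resolve_left hx)⟩
  by_cases h₁ : A 0 1 = 0
  · by_cases h₂ : A 1 0 = 0
    · refine key (A 0 0 - A 1 1) ?_ ?_ ?_ (fun h => hA ⟨h₁, h₂, sub_eq_zero.1 h⟩)
      · linear_combination -b₁ * C 1 0 + B 1 0 * c₁ + (B 0 0 - B 1 1) * c₀ - (C 0 0 - C 1 1) * b₀ +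
          (B 0 0 - B 1 1) * C 0 1 * h₂ - C 0 0 * B 0 1 * h₂ + C 1 1 * B 0 1 * h₂
      · linear_combination -b₁ * (C 0 0 - C 1 1) + c₁ * (B 0 0 - B 1 1)
      · linear_combination -b₂ * (C 0 0 - C 1 1) + c₂ * (B 0 0 - B 1 1)
    · refine key (A 1 0) ?_ ?_ ?_ h₂
      · linear_combination -C 1 0 * b₀ + B 1 0 * c₀
      · linear_combination -(C 0 0 - C 1 1) * b₀ + B 1 0 * c₁ - C 0 1 * b₂
      · linear_combination B 1 0 * c₂ - C 1 0 * b₂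
  · refine key (A 0 1) ?_ ?_ ?_ h₁
    · linear_combination -C 0 1 * b₀ + B 0 1 * c₀
    · linear_combination B 0 1 * c₁ - C 0 1 * b₁
    · linear_combination (C 0 0 - C 1 1) * b₀ + B 0 1 * c₂ - C 1 0 * b₁

theorem tr_conj (A B : SL₂) : tr (B * A * B⁻¹) = tr A := by
  simp only [tr, mul_00, mul_01, mul_10, mul_11, inv_00, inv_01, inv_10, inv_11]
  linear_combination (A 0 0 + A 1 1) * det_eq B

/-- A matrix commuting with the nonscalar matrix `A` is a polynomial in `A`. -/
theorem exists_coeff_of_comm {A C : SL₂} (hA : ¬ IsScalar A) (hC : A * C = C * A) :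
    ∃ k, C 0 1 = k * A 0 1 ∧ C 1 0 = k * A 1 0 ∧ C 0 0 - C 1 1 = k * (A 0 0 - A 1 1) := by
  rw [mul_comm_iff] at hC
  obtain ⟨c₀, c₁, c₂⟩ := hC
  by_cases h₁ : A 0 1 = 0
  · by_cases h₂ : A 1 0 = 0
    · have h₃ : A 0 0 - A 1 1 ≠ 0 := fun h => hA ⟨h₁, h₂, sub_eq_zero.1 h⟩
      refine ⟨(C 0 0 - C 1 1) / (A 0 0 - A 1 1), ?_, ?_, ?_⟩ <;> field_simp
      · linear_combination -c₁
      · linear_combination -c₂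
    · refine ⟨C 1 0 / A 1 0, ?_, ?_, ?_⟩ <;> field_simp
      · linear_combination -c₀
      · linear_combination c₂
  · refine ⟨C 0 1 / A 0 1, ?_, ?_, ?_⟩ <;> field_simp
    · linear_combination c₀
    · linear_combination c₁

theorem eq_or_eq_inv_of_comm {A C : SL₂} (h2 : (2 : F) ≠ 0) (hA : ¬ IsScalar A)
    (ht : tr A ^ 2 ≠ 4) (hC : A * C = C * A) (htC : tr C = tr A) : C = A ∨ C = A⁻¹ := by
  obtain ⟨k, k₁, k₂, k₃⟩ := exists_coeff_of_comm hA hC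
  have hd := det_eq A
  have hd' := det_eq C
  simp only [tr] at ht htC
  have hk : (k - 1) * (k + 1) = 0 := by
    have : ((A 0 0 + A 1 1) ^ 2 - 4) * ((k - 1) * (k + 1)) = 0 := by
      have e : (C 0 0 - C 1 1) ^ 2 + 4 * (C 0 1 * C 1 0) =
          k ^ 2 * ((A 0 0 - A 1 1) ^ 2 + 4 * (A 0 1 * A 1 0)) := by
        rw [k₁, k₂, k₃]; ring
      have e' : (C 0 0 + C 1 1) ^ 2 = (A 0 0 + A 1 1) ^ 2 := by rw [htC]
      linear_combination -e + e' - 4 * hd' + 4 * k ^ 2 * hd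
    exact (mul_eq_zero.1 this).resolve_left (sub_ne_zero.2 ht)
  rcases mul_eq_zero.1 hk with h | h
  · left
    obtain rfl : k = 1 := sub_eq_zero.1 h
    apply ext_entries
    · apply mul_left_cancel₀ h2; linear_combination htC + k₃
    · rw [k₁, one_mul]
    · rw [k₂, one_mul]
    · apply mul_left_cancel₀ h2; linear_combination htC - k₃
  · right
    obtain rfl : k = -1 := eq_neg_of_add_eq_zero_left h
    apply ext_entries <;> simp only [inv_00, inv_01, inv_10, inv_11]
    · apply mul_left_cancel₀ h2; linear_combination htC + k₃
    · rw [k₁, neg_one_mul]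
    · rw [k₂, neg_one_mul]
    · apply mul_left_cancel₀ h2; linear_combination htC - k₃

theorem tr_eq_zero_of_conj_eq_inv {A B : SL₂} (hA : ¬ IsScalar A) (h : B * A * B⁻¹ = A⁻¹) :
    tr B = 0 := by
  have h' : B * A = A⁻¹ * B := by rw [← h]; group
  have h₀ := congrArg (fun M : SL₂ => M 0 0) h'
  have h₁ := congrArg (fun M : SL₂ => M 0 1) h'
  have h₂ := congrArg (fun M : SL₂ => M 1 0) h'
  have h₃ := congrArg (fun M : SL₂ => M 1 1) h'
  simp only [mul_00, mul_01, mul_10, mul_11, inv_00, inv_01, inv_10, inv_11] at h₀ h₁ h₂ h₃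
  have e₁ : A 0 1 * tr B = 0 := by rw [tr]; linear_combination h₁
  have e₂ : A 1 0 * tr B = 0 := by rw [tr]; linear_combination h₂
  have e₃ : (A 0 0 - A 1 1) * tr B = 0 := by rw [tr]; linear_combination h₀ - h₃
  by_contra hB
  exact hA ⟨(mul_eq_zero.1 e₁).resolve_right hB, (mul_eq_zero.1 e₂).resolve_right hB,
    sub_eq_zero.1 ((mul_eq_zero.1 e₃).resolve_right hB)⟩

theorem coe_sq (A : SL₂) :
    (A : Matrix (Fin 2) (Fin 2) F) ^ 2 = tr A • (A : Matrix (Fin 2) (Fin 2) F) - 1 := by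
  have := det_eq A
  ext i j
  fin_cases i <;> fin_cases j <;> simp [pow_two, Matrix.mul_apply, tr]
  · linear_combination -this
  · ring
  · ring
  · linear_combination -this

theorem isScalar_of_coe_eq {A B : SL₂} {u w : F}
    (h : (B : Matrix (Fin 2) (Fin 2) F) = u • (A : Matrix (Fin 2) (Fin 2) F) - w • 1)
    (hB : IsScalar B) (hA : ¬ IsScalar A) : u = 0 := by
  obtain ⟨b₀, b₁, b₂⟩ := hB
  rw [h] at b₀ b₁ b₂
  simp at b₀ b₁ b₂
  by_contra hu
  exact hA ⟨b₀.resolve_left hu, b₁.resolve_left hu, b₂.resolve_right hu⟩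

theorem tr_eq_zero_of_isScalar_sq {A : SL₂} (hA : ¬ IsScalar A) (h : IsScalar (A ^ 2)) :
    tr A = 0 :=
  isScalar_of_coe_eq (w := 1) (by rw [Matrix.SpecialLinearGroup.coe_pow, coe_sq, one_smul]) h hA

theorem tr_sq_of_isScalar_cube {A : SL₂} (hA : ¬ IsScalar A) (h : IsScalar (A ^ 3)) :
    tr A ^ 2 = 1 := by
  refine sub_eq_zero.1 (isScalar_of_coe_eq (w := tr A) ?_ h hA)
  rw [Matrix.SpecialLinearGroup.coe_pow, pow_succ, coe_sq, sub_mul, smul_mul_assoc, ← pow_two,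
    coe_sq, one_mul]
  module

theorem tr_sq_of_isScalar_pow_five {A : SL₂} (hA : ¬ IsScalar A) (h : IsScalar (A ^ 5)) :
    (tr A ^ 2) ^ 2 - 3 * tr A ^ 2 + 1 = 0 := by
  refine isScalar_of_coe_eq (w := tr A ^ 3 - 2 * tr A) ?_ h hA
  have h4 : (A : Matrix (Fin 2) (Fin 2) F) ^ 4 =
      (tr A ^ 3 - 2 * tr A) • (A : Matrix (Fin 2) (Fin 2) F) - (tr A ^ 2 - 1) • 1 := by
    rw [show 4 = 2 * 2 from rfl, pow_mul, coe_sq, pow_two, sub_mul, mul_sub, mul_sub,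
      smul_mul_smul_comm, ← pow_two (A : Matrix (Fin 2) (Fin 2) F), coe_sq]
    simp only [mul_one, one_mul]
    module
  rw [Matrix.SpecialLinearGroup.coe_pow, pow_succ, h4, sub_mul, smul_mul_assoc, ← pow_two, coe_sq]
  simp only [smul_mul_assoc, one_mul]
  module

end SLTwo
end

section
open Matrix

namespace SLTwo

variable {F : Type*} [Field F]

local notation "SL₂" => Matrix.SpecialLinearGroup (Fin 2) F
local notation "PSL₂" => Matrix.ProjectiveSpecialLinearGroup (Fin 2) F

/-- The projection from `SL₂` to `PSL₂`. -/
def proj : SL₂ →* PSL₂ := QuotientGroup.mk' _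

theorem proj_surjective : Function.Surjective (proj : SL₂ →* PSL₂) :=
  QuotientGroup.mk'_surjective _

theorem mem_center_iff {A : SL₂} : A ∈ Subgroup.center SL₂ ↔ IsScalar A := by
  rw [Matrix.SpecialLinearGroup.mem_center_iff]
  constructor
  · rintro ⟨r, -, h⟩
    simp [IsScalar, ← h]
  · rintro ⟨h₁, h₂, h₃⟩
    have := det_eq A
    refine ⟨A 0 0, ?_, ?_⟩
    · rw [← h₃, h₁] at this
      simpa [pow_two] using this
    · ext i j
      fin_cases i <;> fin_cases j <;> simp [h₁, h₂, h₃]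

theorem proj_eq_one_iff {A : SL₂} : proj A = 1 ↔ IsScalar A := by
  rw [← mem_center_iff]
  exact QuotientGroup.eq_one_iff A

theorem eq_one_or_neg_one_of_isScalar {A : SL₂} (hA : IsScalar A) :
    A 0 0 = 1 ∨ A 0 0 = -1 := by
  obtain ⟨h₁, h₂, h₃⟩ := hA
  have := det_eq A
  rw [← h₃, h₁] at this
  exact mul_self_eq_one_iff.1 (by linear_combination this)

theorem exists_of_proj_eq {A B : SL₂} (h : proj A = proj B) :
    ∃ z ∈ Subgroup.center SL₂, B = A * z :=
  ⟨A⁻¹ * B, QuotientGroup.eq.1 h, by group⟩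

theorem exists_sign_of_proj_eq {A B : SL₂} (h : proj A = proj B) :
    ∃ e : F, (e = 1 ∨ e = -1) ∧ ∀ i j, B i j = e * A i j := by
  obtain ⟨z, hz, rfl⟩ := exists_of_proj_eq h
  rw [mem_center_iff] at hz
  refine ⟨z 0 0, eq_one_or_neg_one_of_isScalar hz, fun i j => ?_⟩
  obtain ⟨h₁, h₂, h₃⟩ := hz
  rw [Matrix.SpecialLinearGroup.coe_mul, Matrix.mul_apply, Fin.sum_univ_two]
  fin_cases j <;> simp [h₁, h₂, ← h₃, mul_comm]

/-- The square of the trace of a lift. -/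
noncomputable def trsq (x : PSL₂) : F := tr x.out ^ 2

theorem trsq_proj (A : SL₂) : trsq (proj A) = tr A ^ 2 := by
  obtain ⟨e, he, h⟩ := exists_sign_of_proj_eq (A := A) (B := (proj A).out)
    (QuotientGroup.out_eq' (proj A)).symm
  rw [trsq, tr, h, h, tr]
  rcases he with rfl | rfl <;> ring

theorem trsq_one : trsq (1 : PSL₂) = 4 := by
  rw [← map_one proj, trsq_proj]
  simp [tr]
  norm_num

/-- The image in `PSL₂` of the centralizer of a lift. -/
noncomputable def torus (x : PSL₂) : Subgroup PSL₂ :=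
  (Subgroup.centralizer {x.out}).map proj

theorem proj_mem_torus {A B : SL₂} : proj B ∈ torus (proj A) ↔ A * B = B * A := by
  obtain ⟨z, hz, h⟩ := exists_of_proj_eq (A := A) (B := (proj A).out)
    (QuotientGroup.out_eq' (proj A)).symm
  rw [Subgroup.mem_center_iff] at hz
  have key : ∀ C : SL₂, (proj A).out * C = C * (proj A).out ↔ A * C = C * A := fun C => by
    rw [h, mul_assoc, ← hz C, ← mul_assoc, ← mul_assoc, mul_left_inj]
  rw [torus, Subgroup.mem_map]
  constructor
  · rintro ⟨C, hC, hCB⟩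
    obtain ⟨w, hw, rfl⟩ := exists_of_proj_eq hCB
    rw [Subgroup.mem_center_iff] at hw
    rw [Subgroup.mem_centralizer_singleton_iff, eq_comm, key] at hC
    rw [← mul_assoc, hC, mul_assoc, hw, mul_assoc]
  · intro hB
    exact ⟨B, by rwa [Subgroup.mem_centralizer_singleton_iff, eq_comm, key], rfl⟩

theorem torus_isConjPartition : IsConjPartition (torus : PSL₂ → Subgroup PSL₂) where
  self_mem x := by
    obtain ⟨A, rfl⟩ := proj_surjective x
    rw [proj_mem_torus]
  eq_of_mem x y hx hy h := by
    obtain ⟨A, rfl⟩ := proj_surjective x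
    obtain ⟨B, rfl⟩ := proj_surjective y
    rw [proj_mem_torus] at h
    rw [Ne, proj_eq_one_iff] at hx hy
    ext z
    obtain ⟨C, rfl⟩ := proj_surjective z
    rw [proj_mem_torus, proj_mem_torus]
    exact ⟨comm_of_comm hy h.symm, comm_of_comm hx h⟩
  conj_mem k x y h := by
    obtain ⟨A, rfl⟩ := proj_surjective x
    obtain ⟨B, rfl⟩ := proj_surjective y
    obtain ⟨C, rfl⟩ := proj_surjective k
    rw [proj_mem_torus] at h
    rw [← map_inv, ← map_mul, ← map_mul, ← map_mul, ← map_mul, proj_mem_torus]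
    simp only [mul_assoc, inv_mul_cancel_left, ← mul_assoc A B, h]

theorem conj_eq_or_eq_inv {A B : SL₂} (h2 : (2 : F) ≠ 0) (hA : ¬ IsScalar A) (ht : tr A ^ 2 ≠ 4)
    (h : proj B * proj A * (proj B)⁻¹ ∈ torus (proj A)) : B * A * B⁻¹ = A ∨ B * A * B⁻¹ = A⁻¹ := by
  rw [← map_inv, ← map_mul, ← map_mul, proj_mem_torus] at h
  exact eq_or_eq_inv_of_comm h2 hA ht h (tr_conj A B)

theorem conj_eq_inv {A B : SL₂} (h2 : (2 : F) ≠ 0) (hA : ¬ IsScalar A) (ht : tr A ^ 2 ≠ 4)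
    (h : proj B * proj A * (proj B)⁻¹ ∈ torus (proj A)) (hB : proj B ∉ torus (proj A)) :
    B * A * B⁻¹ = A⁻¹ := by
  refine (conj_eq_or_eq_inv h2 hA ht h).resolve_left fun h' => hB ?_
  rw [proj_mem_torus]
  exact (mul_inv_eq_iff_eq_mul.1 h').symm

theorem mul_mem_torus {x y z : PSL₂} (h2 : (2 : F) ≠ 0) (hx : x ≠ 1) (ht : trsq x ≠ 4)
    (hy : y * x * y⁻¹ ∈ torus x) (hz : z * x * z⁻¹ ∈ torus x) (hy' : y ∉ torus x)
    (hz' : z ∉ torus x) : y * z ∈ torus x := by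
  obtain ⟨A, rfl⟩ := proj_surjective x
  obtain ⟨B, rfl⟩ := proj_surjective y
  obtain ⟨C, rfl⟩ := proj_surjective z
  rw [Ne, proj_eq_one_iff] at hx
  rw [trsq_proj] at ht
  have hB := conj_eq_inv h2 hx ht hy hy'
  have hC := conj_eq_inv h2 hx ht hz hz'
  rw [← map_mul, proj_mem_torus]
  have hB' : B * A⁻¹ * B⁻¹ = A := by
    rw [← _root_.inv_inj]
    exact (by group : (B * A⁻¹ * B⁻¹)⁻¹ = B * A * B⁻¹).trans hB
  have : B * C * A * (B * C)⁻¹ = A := by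
    rw [show B * C * A * (B * C)⁻¹ = B * (C * A * C⁻¹) * B⁻¹ by group, hC, hB']
  exact (mul_inv_eq_iff_eq_mul.1 this).symm

/-- An element outside the torus that normalizes it is an involution. -/
theorem sq_eq_one_of_not_mem_torus {x y : PSL₂} (h2 : (2 : F) ≠ 0) (hx : x ≠ 1) (ht : trsq x ≠ 4)
    (hy : y * x * y⁻¹ ∈ torus x) (hy' : y ∉ torus x) : trsq y = 0 ∧ y ^ 2 = 1 := by
  obtain ⟨A, rfl⟩ := proj_surjective x
  obtain ⟨B, rfl⟩ := proj_surjective y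
  rw [Ne, proj_eq_one_iff] at hx
  rw [trsq_proj] at ht
  have h0 := tr_eq_zero_of_conj_eq_inv hx (conj_eq_inv h2 hx ht hy hy')
  rw [trsq_proj, h0, ← map_pow, proj_eq_one_iff]
  have := coe_sq B
  rw [h0, zero_smul, zero_sub, ← Matrix.SpecialLinearGroup.coe_pow] at this
  simp [IsScalar, this]

/-- Every nontrivial element has distinct eigenvalues. -/
def IsRegular (K : Subgroup PSL₂) : Prop := ∀ x ∈ K, x ≠ 1 → trsq x ≠ 4

theorem IsRegular.mono {K L : Subgroup PSL₂} (hL : IsRegular L) (h : K ≤ L) : IsRegular K :=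
  fun x hx => hL x (h hx)

/-- The torus of an element of a subgroup, inside this subgroup. -/
noncomputable def subTorus (K : Subgroup PSL₂) (x : K) : Subgroup K :=
  (torus (x : PSL₂)).subgroupOf K

theorem mem_subTorus {K : Subgroup PSL₂} {x y : K} :
    y ∈ subTorus K x ↔ (y : PSL₂) ∈ torus (x : PSL₂) :=
  Subgroup.mem_subgroupOf

theorem IsRegular.isToralPartition {K : Subgroup PSL₂} (hK : IsRegular K) (h2 : (2 : F) ≠ 0) :
    IsToralPartition (subTorus K) := by
  have hne : ∀ {x : K}, x ≠ 1 → (x : PSL₂) ≠ 1 := fun hx h => hx (Subtype.ext h)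
  refine ⟨⟨fun x => ?_, fun x y hx hy h => ?_, fun k x y h => ?_⟩, fun x y z hx hy hz hy' hz' => ?_⟩
  · rw [mem_subTorus]
    exact torus_isConjPartition.self_mem _
  · rw [mem_subTorus] at h
    have := torus_isConjPartition.eq_of_mem _ _ (hne hx) (hne hy) h
    ext z
    rw [mem_subTorus, mem_subTorus, this]
  · rw [mem_subTorus] at h ⊢
    simp only [Subgroup.coe_mul, Subgroup.coe_inv]
    exact torus_isConjPartition.conj_mem _ _ _ h
  · simp only [mem_subTorus, Subgroup.coe_mul, Subgroup.coe_inv] at *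
    exact mul_mem_torus h2 (hne hx) (hK x x.2 (hne hx)) hy hz hy' hz'

theorem trsq_of_sq_eq_one {x : PSL₂} (hx : x ≠ 1) (h : x ^ 2 = 1) : trsq x = 0 := by
  obtain ⟨A, rfl⟩ := proj_surjective x
  rw [Ne, proj_eq_one_iff] at hx
  rw [← map_pow, proj_eq_one_iff] at h
  rw [trsq_proj, tr_eq_zero_of_isScalar_sq hx h, zero_pow two_ne_zero]

theorem trsq_of_cube_eq_one {x : PSL₂} (hx : x ≠ 1) (h : x ^ 3 = 1) : trsq x = 1 := by
  obtain ⟨A, rfl⟩ := proj_surjective x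
  rw [Ne, proj_eq_one_iff] at hx
  rw [← map_pow, proj_eq_one_iff] at h
  rw [trsq_proj, tr_sq_of_isScalar_cube hx h]

theorem trsq_of_pow_five_eq_one {x : PSL₂} (hx : x ≠ 1) (h : x ^ 5 = 1) :
    trsq x ^ 2 - 3 * trsq x + 1 = 0 := by
  obtain ⟨A, rfl⟩ := proj_surjective x
  rw [Ne, proj_eq_one_iff] at hx
  rw [← map_pow, proj_eq_one_iff] at h
  rw [trsq_proj, tr_sq_of_isScalar_pow_five hx h]

end SLTwo
end

section
open Matrix

namespace SLTwo

variable {F : Type*} [Field F]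

local notation "SL₂" => Matrix.SpecialLinearGroup (Fin 2) F
local notation "PSL₂" => Matrix.ProjectiveSpecialLinearGroup (Fin 2) F

/-- The vector `v` is an eigenvector of `A` (or zero). -/
def FixesLine (v : F × F) (A : SL₂) : Prop :=
  ∃ k, A 0 0 * v.1 + A 0 1 * v.2 = k * v.1 ∧ A 1 0 * v.1 + A 1 1 * v.2 = k * v.2

/-- The stabilizer in `PSL₂` of the line spanned by `v`. -/
def lineStab (v : F × F) : Subgroup PSL₂ :=
  Subgroup.map proj
    { carrier := {A | FixesLine v A}
      one_mem' := ⟨1, by simp, by simp⟩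
      mul_mem' := by
        rintro A B ⟨k, h₁, h₂⟩ ⟨l, h₃, h₄⟩
        refine ⟨k * l, ?_, ?_⟩ <;> simp only [mul_00, mul_01, mul_10, mul_11]
        · linear_combination l * h₁ + A 0 0 * h₃ + A 0 1 * h₄
        · linear_combination l * h₂ + A 1 0 * h₃ + A 1 1 * h₄
      inv_mem' := by
        rintro A ⟨k, h₁, h₂⟩
        have := det_eq A
        have e₁ : k * (A 1 1 * v.1 - A 0 1 * v.2) = v.1 := by
          linear_combination -A 1 1 * h₁ + A 0 1 * h₂ + v.1 * this
        have e₂ : k * (-A 1 0 * v.1 + A 0 0 * v.2) = v.2 := by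
          linear_combination A 1 0 * h₁ - A 0 0 * h₂ + v.2 * this
        refine ⟨k⁻¹, ?_⟩
        simp only [inv_00, inv_01, inv_10, inv_11]
        by_cases hk : k = 0
        · rw [hk, zero_mul] at e₁ e₂
          simp [← e₁, ← e₂]
        · constructor <;> field_simp
          · linear_combination e₁
          · linear_combination e₂ }

theorem proj_mem_lineStab {v : F × F} {A : SL₂} : proj A ∈ lineStab v ↔ FixesLine v A := by
  rw [lineStab, Subgroup.mem_map]
  refine ⟨?_, fun h => ⟨A, h, rfl⟩⟩
  rintro ⟨B, ⟨k, h₁, h₂⟩, h⟩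
  obtain ⟨e, -, he⟩ := exists_sign_of_proj_eq h
  refine ⟨e * k, ?_, ?_⟩ <;> rw [he, he]
  · linear_combination e * h₁
  · linear_combination e * h₂

/-- The vectors `v` and `w` are proportional. -/
def Parallel (v w : F × F) : Prop := v.1 * w.2 = v.2 * w.1

theorem eq_zero_of_not_parallel {v w : F × F} (hvw : ¬ Parallel v w) {x y : F}
    (hv : x * v.1 + y * v.2 = 0) (hw : x * w.1 + y * w.2 = 0) : x = 0 ∧ y = 0 := by
  have hd : v.1 * w.2 - v.2 * w.1 ≠ 0 := sub_ne_zero.2 hvw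
  constructor
  · apply mul_right_cancel₀ hd
    linear_combination w.2 * hv - v.2 * hw
  · apply mul_right_cancel₀ hd
    linear_combination v.1 * hw - w.1 * hv

theorem FixesLine.comm_of_not_parallel {v w : F × F} (hvw : ¬ Parallel v w) {A B : SL₂}
    (hAv : FixesLine v A) (hAw : FixesLine w A) (hBv : FixesLine v B) (hBw : FixesLine w B) :
    A * B = B * A := by
  have key : ∀ u : F × F, FixesLine u A → FixesLine u B →
      ((A * B) 0 0 - (B * A) 0 0) * u.1 + ((A * B) 0 1 - (B * A) 0 1) * u.2 = 0 ∧
      ((A * B) 1 0 - (B * A) 1 0) * u.1 + ((A * B) 1 1 - (B * A) 1 1) * u.2 = 0 := by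
    rintro u ⟨k, h₁, h₂⟩ ⟨l, h₃, h₄⟩
    simp only [mul_00, mul_01, mul_10, mul_11]
    constructor
    · linear_combination A 0 0 * h₃ + A 0 1 * h₄ + l * h₁ - B 0 0 * h₁ - B 0 1 * h₂ - k * h₃
    · linear_combination A 1 0 * h₃ + A 1 1 * h₄ + l * h₂ - B 1 0 * h₁ - B 1 1 * h₂ - k * h₄
  obtain ⟨v₁, v₂⟩ := key v hAv hBv
  obtain ⟨w₁, w₂⟩ := key w hAw hBw
  obtain ⟨h₁, h₂⟩ := eq_zero_of_not_parallel hvw v₁ w₁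
  obtain ⟨h₃, h₄⟩ := eq_zero_of_not_parallel hvw v₂ w₂
  exact ext_entries (sub_eq_zero.1 h₁) (sub_eq_zero.1 h₂) (sub_eq_zero.1 h₃) (sub_eq_zero.1 h₄)

theorem lineStab_inf_le_torus {v w : F × F} (hvw : ¬ Parallel v w) {g : PSL₂}
    (hg : g ∈ lineStab v ⊓ lineStab w) : lineStab v ⊓ lineStab w ≤ torus g := by
  intro y hy
  obtain ⟨A, rfl⟩ := proj_surjective g
  obtain ⟨B, rfl⟩ := proj_surjective y
  rw [Subgroup.mem_inf, proj_mem_lineStab, proj_mem_lineStab] at hg hy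
  rw [proj_mem_torus]
  exact FixesLine.comm_of_not_parallel hvw hg.1 hg.2 hy.1 hy.2

theorem lineStab_le_of_parallel {v w : F × F} (hv : v ≠ 0) (hvw : Parallel v w) :
    lineStab v ≤ lineStab w := by
  intro y hy
  obtain ⟨A, rfl⟩ := proj_surjective y
  rw [proj_mem_lineStab] at hy ⊢
  obtain ⟨k, h₁, h₂⟩ := hy
  rw [Parallel] at hvw
  refine ⟨k, ?_⟩
  by_cases h : v.1 = 0
  · have h' : v.2 ≠ 0 := fun h' => hv (Prod.ext h h')
    constructor <;> apply mul_left_cancel₀ h'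
    · linear_combination w.2 * h₁ - A 0 0 * hvw + k * hvw
    · linear_combination w.2 * h₂ - A 1 0 * hvw
  · constructor <;> apply mul_left_cancel₀ h
    · linear_combination w.1 * h₁ + A 0 1 * hvw
    · linear_combination w.1 * h₂ + A 1 1 * hvw - k * hvw

theorem FixesLine.charpoly_eq_zero {v : F × F} (hv : v ≠ 0) {A : SL₂} {k : F}
    (h₁ : A 0 0 * v.1 + A 0 1 * v.2 = k * v.1) (h₂ : A 1 0 * v.1 + A 1 1 * v.2 = k * v.2) :
    k ^ 2 - tr A * k + 1 = 0 := by
  have hd := det_eq A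
  have e₁ : (k ^ 2 - tr A * k + 1) * v.1 = 0 := by
    rw [tr]; linear_combination (A 1 1 - k) * h₁ - A 0 1 * h₂ - v.1 * hd
  have e₂ : (k ^ 2 - tr A * k + 1) * v.2 = 0 := by
    rw [tr]; linear_combination (A 0 0 - k) * h₂ - A 1 0 * h₁ - v.2 * hd
  by_contra h
  exact hv (Prod.ext ((mul_eq_zero.1 e₁).resolve_left h) ((mul_eq_zero.1 e₂).resolve_left h))

theorem parallel_of_trsq_eq_four (h2 : (2 : F) ≠ 0) {v w : F × F} (hv : v ≠ 0) (hw : w ≠ 0)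
    {x : PSL₂} (hx : x ≠ 1) (ht : trsq x = 4) (hxv : x ∈ lineStab v) (hxw : x ∈ lineStab w) :
    Parallel v w := by
  obtain ⟨A, rfl⟩ := proj_surjective x
  rw [trsq_proj] at ht
  rw [Ne, proj_eq_one_iff] at hx
  rw [proj_mem_lineStab] at hxv hxw
  obtain ⟨k, h₁, h₂⟩ := hxv
  obtain ⟨l, h₃, h₄⟩ := hxw
  have key : ∀ k, k ^ 2 - tr A * k + 1 = 0 → 2 * k = tr A := fun k hk => by
    apply sub_eq_zero.1
    apply pow_eq_zero_iff two_ne_zero |>.1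
    linear_combination 4 * hk + ht
  have hk := key k (FixesLine.charpoly_eq_zero hv h₁ h₂)
  have hl := key l (FixesLine.charpoly_eq_zero hw h₃ h₄)
  obtain rfl : k = l := mul_left_cancel₀ h2 (hk.trans hl.symm)
  by_contra hvw
  obtain ⟨e₁, e₂⟩ := eq_zero_of_not_parallel hvw (x := A 0 0 - k) (y := A 0 1)
    (by linear_combination h₁) (by linear_combination h₃)
  obtain ⟨e₃, e₄⟩ := eq_zero_of_not_parallel hvw (x := A 1 0) (y := A 1 1 - k)
    (by linear_combination h₂) (by linear_combination h₄)
  exact hx ⟨e₂, e₃, by linear_combination e₁ - e₄⟩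

theorem IsRegular.mem_torus_of_le_lineStab (h2 : (2 : F) ≠ 0) {K : Subgroup PSL₂}
    (hK : IsRegular K) {v : F × F} (hv : v ≠ 0) (hKv : K ≤ lineStab v) {x y : PSL₂} (hx : x ∈ K)
    (hy : y ∈ K) : y ∈ torus x := by
  have hx' := hKv hx
  have hy' := hKv hy
  obtain ⟨A, rfl⟩ := proj_surjective x
  obtain ⟨B, rfl⟩ := proj_surjective y
  rw [proj_mem_lineStab] at hx' hy'
  obtain ⟨k, h₁, h₂⟩ := hx'
  obtain ⟨l, h₃, h₄⟩ := hy'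
  set C := (A * B) * (B * A)⁻¹ with hC
  have hC' : C * (B * A) = A * B := by rw [hC]; group
  have hAk := FixesLine.charpoly_eq_zero hv h₁ h₂
  have hBl := FixesLine.charpoly_eq_zero hv h₃ h₄
  have hk : k ≠ 0 := by rintro rfl; simp at hAk
  have hl : l ≠ 0 := by rintro rfl; simp at hBl
  have e₀ := congrArg (fun M : SL₂ => M 0 0) hC'
  have e₁ := congrArg (fun M : SL₂ => M 0 1) hC'
  have e₂ := congrArg (fun M : SL₂ => M 1 0) hC'
  have e₃ := congrArg (fun M : SL₂ => M 1 1) hC'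
  simp only [mul_00 C, mul_01 C, mul_10 C, mul_11 C] at e₀ e₁ e₂ e₃
  have f₁ : (A * B) 0 0 * v.1 + (A * B) 0 1 * v.2 = k * l * v.1 := by
    simp only [mul_00, mul_01]
    linear_combination A 0 0 * h₃ + A 0 1 * h₄ + l * h₁
  have f₂ : (A * B) 1 0 * v.1 + (A * B) 1 1 * v.2 = k * l * v.2 := by
    simp only [mul_10, mul_11]
    linear_combination A 1 0 * h₃ + A 1 1 * h₄ + l * h₂
  have f₃ : (B * A) 0 0 * v.1 + (B * A) 0 1 * v.2 = k * l * v.1 := by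
    simp only [mul_00, mul_01]
    linear_combination B 0 0 * h₁ + B 0 1 * h₂ + k * h₃
  have f₄ : (B * A) 1 0 * v.1 + (B * A) 1 1 * v.2 = k * l * v.2 := by
    simp only [mul_10, mul_11]
    linear_combination B 1 0 * h₁ + B 1 1 * h₂ + k * h₄
  have g₁ : C 0 0 * v.1 + C 0 1 * v.2 = 1 * v.1 := by
    apply mul_left_cancel₀ (mul_ne_zero hk hl)
    linear_combination v.1 * e₀ + v.2 * e₁ + f₁ - C 0 0 * f₃ - C 0 1 * f₄
  have g₂ : C 1 0 * v.1 + C 1 1 * v.2 = 1 * v.2 := by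
    apply mul_left_cancel₀ (mul_ne_zero hk hl)
    linear_combination v.1 * e₂ + v.2 * e₃ + f₂ - C 1 0 * f₃ - C 1 1 * f₄
  have htC : tr C = 2 := by linear_combination -FixesLine.charpoly_eq_zero hv g₁ g₂
  have hCK : proj C ∈ K := by
    rw [hC, map_mul, map_inv, map_mul, map_mul]
    exact K.mul_mem (K.mul_mem hx hy) (K.inv_mem (K.mul_mem hy hx))
  have hC1 : proj C = 1 := by
    by_contra h
    exact hK _ hCK h (by rw [trsq_proj, htC]; norm_num)
  rw [proj_eq_one_iff] at hC1
  rw [proj_mem_torus, ← hC', mul_eq_right]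
  have h00 : C 0 0 = 1 := by
    apply mul_left_cancel₀ h2
    rw [tr, ← hC1.2.2] at htC
    linear_combination htC
  exact ext_entries (by simpa using h00) (by simpa using hC1.1) (by simpa using hC1.2.1)
    (by simpa [← hC1.2.2] using h00)

theorem transvection_01 (t : F) :
    ((Matrix.SpecialLinearGroup.transvection (show (0 : Fin 2) ≠ 1 by decide) t : SL₂) :
      Matrix (Fin 2) (Fin 2) F) = !![1, t; 0, 1] := by
  rw [Matrix.SpecialLinearGroup.transvection_coe]
  ext i j
  fin_cases i <;> fin_cases j <;> simp

theorem transvection_10 (t : F) :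
    ((Matrix.SpecialLinearGroup.transvection (show (1 : Fin 2) ≠ 0 by decide) t : SL₂) :
      Matrix (Fin 2) (Fin 2) F) = !![1, 0; t, 1] := by
  rw [Matrix.SpecialLinearGroup.transvection_coe]
  ext i j
  fin_cases i <;> fin_cases j <;> simp

theorem lineStab_ne_top {v : F × F} (hv : v ≠ 0) : lineStab v ≠ ⊤ := by
  intro h
  have key : ∀ A : SL₂, FixesLine v A := fun A => proj_mem_lineStab.1 (h ▸ Subgroup.mem_top _)
  obtain ⟨k, h₁, h₂⟩ := key
    (Matrix.SpecialLinearGroup.transvection (show (0 : Fin 2) ≠ 1 by decide) 1)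
  obtain ⟨l, h₃, h₄⟩ := key
    (Matrix.SpecialLinearGroup.transvection (show (1 : Fin 2) ≠ 0 by decide) 1)
  rw [transvection_01] at h₁ h₂
  rw [transvection_10] at h₃ h₄
  simp at h₁ h₂ h₃ h₄
  refine hv (Prod.ext ?_ ?_)
  · apply pow_eq_zero_iff two_ne_zero |>.1
    linear_combination v.1 * h₄ - v.2 * h₃
  · apply pow_eq_zero_iff two_ne_zero |>.1
    linear_combination v.2 * h₁ - v.1 * h₂

theorem normalizer_torus_ne_top (h2 : (2 : F) ≠ 0) {x : PSL₂} (hx : x ≠ 1) (ht : trsq x ≠ 4) :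
    Subgroup.normalizer (torus x : Set PSL₂) ≠ ⊤ := by
  intro h
  obtain ⟨A, rfl⟩ := proj_surjective x
  have key : ∀ B : SL₂, tr B = 2 → A * B = B * A := fun B hB => by
    by_contra hc
    rw [← proj_mem_torus] at hc
    have h0 := (sq_eq_one_of_not_mem_torus h2 hx ht
      ((torus_isConjPartition.mem_normalizer_iff hx).1 (h ▸ Subgroup.mem_top (proj B))) hc).1
    rw [trsq_proj, hB] at h0
    exact h2 ((pow_eq_zero_iff two_ne_zero).1 h0)
  have h₁ := key
    (Matrix.SpecialLinearGroup.transvection (show (0 : Fin 2) ≠ 1 by decide) 1)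
    (by rw [tr, transvection_01]; norm_num)
  have h₂ := key
    (Matrix.SpecialLinearGroup.transvection (show (1 : Fin 2) ≠ 0 by decide) 1)
    (by rw [tr, transvection_10]; norm_num)
  rw [mul_comm_iff, transvection_01] at h₁
  rw [mul_comm_iff, transvection_10] at h₂
  simp at h₁ h₂
  rw [Ne, proj_eq_one_iff] at hx
  exact hx ⟨h₂.1, h₁.1.symm, sub_eq_zero.1 h₁.2.symm⟩

end SLTwo
end

section
open Matrix

namespace SLTwo

variable {p : ℕ} [Fact p.Prime]

local notation "SL₂" => Matrix.SpecialLinearGroup (Fin 2) (ZMod p)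
local notation "PSL₂" => Matrix.ProjectiveSpecialLinearGroup (Fin 2) (ZMod p)

theorem eq_top_of_transvections {F : Type*} [Field F]
    {K : Subgroup (Matrix.ProjectiveSpecialLinearGroup (Fin 2) F)}
    (h₁ : ∀ A : Matrix.SpecialLinearGroup (Fin 2) F, A 0 0 = 1 → A 1 0 = 0 → A 1 1 = 1 → proj A ∈ K)
    (h₂ : ∀ A : Matrix.SpecialLinearGroup (Fin 2) F, A 0 0 = 1 → A 0 1 = 0 → A 1 1 = 1 →
      proj A ∈ K) :
    K = ⊤ := by
  rw [eq_top_iff]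
  intro y _
  obtain ⟨B, rfl⟩ := proj_surjective y
  change B ∈ K.comap proj
  refine SL2.transvection_induction _ (fun i j hij a => ?_) (fun _ _ => mul_mem) B
  rw [Subgroup.mem_comap]
  fin_cases i <;> fin_cases j
  · exact absurd rfl hij
  · apply h₁ <;> simp [Matrix.SpecialLinearGroup.transvection_coe]
  · apply h₂ <;> simp [Matrix.SpecialLinearGroup.transvection_coe]
  · exact absurd rfl hij

theorem eq_top_or_le_lineStab_of_upper {K : Subgroup PSL₂} {A : SL₂} (hA : proj A ∈ K)
    (h1 : proj A ≠ 1) (ht : tr A ^ 2 = 4) (h10 : A 1 0 = 0) :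
    K = ⊤ ∨ K ≤ lineStab (1, 0) := by
  rw [or_iff_not_imp_right]
  intro hK
  rw [Ne, proj_eq_one_iff] at h1
  have hd := det_eq A
  rw [h10] at hd
  have had : A 0 0 = A 1 1 := by
    rw [tr] at ht
    apply sub_eq_zero.1
    apply pow_eq_zero_iff two_ne_zero |>.1
    linear_combination ht - 4 * hd
  have hs : A 0 1 ≠ 0 := fun h => h1 ⟨h, h10, had⟩
  have hp : ∀ n : ℕ, (A ^ n) 1 0 = 0 ∧ (A ^ n) 0 0 = (A ^ n) 1 1 ∧
      (A ^ n) 0 1 = n * (A 0 1 * A 0 0 * (A ^ n) 0 0) := fun n => by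
    induction n with
    | zero => simp
    | succ n ih =>
      obtain ⟨i₁, i₂, i₃⟩ := ih
      rw [← had] at hd
      simp only [pow_succ (n := n), mul_00, mul_01, mul_10, mul_11, i₁, h10, ← i₂, ← had, i₃]
      refine ⟨by ring, by ring, ?_⟩
      push_cast
      linear_combination (-A 0 1 * (A ^ n) 0 0) * hd
  have hU : ∀ B : SL₂, B 0 0 = 1 → B 1 0 = 0 → B 1 1 = 1 → proj B ∈ K := by
    intro B h00 h10' h11
    have hz : (B 0 1 / (A 0 1 * A 0 0)).val = B 0 1 / (A 0 1 * A 0 0) := ZMod.natCast_zmod_val _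
    set n := (B 0 1 / (A 0 1 * A 0 0)).val
    obtain ⟨i₁, i₂, i₃⟩ := hp n
    have hdn := det_eq (A ^ n)
    have h0 : A 0 0 ≠ 0 := by rintro h; rw [h] at hd; simp at hd
    have e : proj B = proj (A ^ n) := by
      rw [← inv_mul_eq_one, ← map_inv, ← map_mul, proj_eq_one_iff]
      refine ⟨?_, ?_, ?_⟩ <;>
        simp only [mul_00, mul_01, mul_10, mul_11, inv_00, inv_01, inv_10, inv_11, h00, h10', h11,
          i₁, ← i₂, i₃, hz]
      · field_simp; ring
      · ring
      · ring
    rw [e, map_pow]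
    exact K.pow_mem hA n
  obtain ⟨y, hyK, hy⟩ := SetLike.not_le_iff_exists.1 hK
  obtain ⟨B, rfl⟩ := proj_surjective y
  have hc : B 1 0 ≠ 0 := fun h => hy (proj_mem_lineStab.2 ⟨B 0 0, by simp, by simp [h]⟩)
  have hdB := det_eq B
  obtain ⟨W, hW, hW'⟩ : ∃ W : SL₂, proj W ∈ K ∧ W 0 0 = 0 ∧ W 1 1 = 0 := by
    let U : ZMod p → SL₂ := fun t => ⟨!![1, t; 0, 1], by simp [Matrix.det_fin_two]⟩
    have hUK : ∀ t, proj (U t) ∈ K := fun t => hU _ (by simp [U]) (by simp [U]) (by simp [U])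
    refine ⟨U (-B 0 0 / B 1 0) * B * U (-B 1 1 / B 1 0), ?_, ?_, ?_⟩
    · rw [map_mul, map_mul]
      exact K.mul_mem (K.mul_mem (hUK _) hyK) (hUK _)
    · simp only [mul_00, mul_01]
      simp [U]
      field_simp; ring
    · simp only [mul_10, mul_11]
      simp [U]
      field_simp; ring
  refine eq_top_of_transvections hU fun C h00 h01 h11 => ?_
  have hdW := det_eq W
  rw [hW'.1, hW'.2] at hdW
  have : proj (W * C * W⁻¹) ∈ K := by
    apply hU <;> simp only [mul_00, mul_01, mul_10, mul_11, inv_00, inv_01, inv_10, inv_11, h00,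
      h01, h11, hW'.1, hW'.2]
    · linear_combination hdW
    · ring
    · linear_combination hdW
  rw [map_mul, map_mul, map_inv] at this
  have := K.mul_mem (K.mul_mem (K.inv_mem hW) this) hW
  simpa [mul_assoc] using this

theorem FixesLine.of_conj {F : Type*} [Field F] {Q B : Matrix.SpecialLinearGroup (Fin 2) F}
    (h : FixesLine (1, 0) (Q⁻¹ * B * Q)) : FixesLine (Q 0 0, Q 1 0) B := by
  obtain ⟨k, h₁, h₂⟩ := h
  have e : Q * (Q⁻¹ * B * Q) = B * Q := by group
  generalize Q⁻¹ * B * Q = C at *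
  have e₀ := congrArg (fun M : Matrix.SpecialLinearGroup (Fin 2) F => M 0 0) e
  have e₁ := congrArg (fun M : Matrix.SpecialLinearGroup (Fin 2) F => M 1 0) e
  simp only [mul_00, mul_10] at e₀ e₁
  refine ⟨k, ?_, ?_⟩
  · linear_combination -e₀ + Q 0 0 * h₁ + Q 0 1 * h₂
  · linear_combination -e₁ + Q 1 0 * h₁ + Q 1 1 * h₂

theorem eq_top_or_exists_le_lineStab (h2 : (2 : ZMod p) ≠ 0) {K : Subgroup PSL₂} {x : PSL₂}
    (hxK : x ∈ K) (hx : x ≠ 1) (ht : trsq x = 4) : K = ⊤ ∨ ∃ v, v ≠ 0 ∧ K ≤ lineStab v := by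
  obtain ⟨A, rfl⟩ := proj_surjective x
  rw [trsq_proj] at ht
  by_cases hc : A 1 0 = 0
  · exact (eq_top_or_le_lineStab_of_upper hxK hx ht hc).imp_right fun h => ⟨(1, 0), by simp, h⟩
  let Q : SL₂ := ⟨!![(A 0 0 - A 1 1) / 2, -1 / A 1 0; A 1 0, 0], by
    rw [Matrix.det_fin_two]; simp; field_simp⟩
  have hmem : ∀ y, y ∈ K.comap (MulAut.conj (proj Q)).toMonoidHom ↔
      proj Q * y * (proj Q)⁻¹ ∈ K := fun y => Iff.rfl
  have key := eq_top_or_le_lineStab_of_upper (K := K.comap (MulAut.conj (proj Q)).toMonoidHom)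
    (A := Q⁻¹ * A * Q) (by rw [hmem]; simpa [mul_assoc] using hxK)
    (by simpa using conj_ne_one hx (proj Q)⁻¹)
    (by have := tr_conj A Q⁻¹; rw [inv_inv] at this; rwa [this]) (by
      rw [tr] at ht
      have hd := det_eq A
      simp only [mul_10, mul_11, inv_10, inv_11]
      simp [Q]
      field_simp
      linear_combination (-A 1 0) * (ht - 4 * hd))
  rcases key with h | h
  · left
    rw [eq_top_iff]
    intro y _
    have := (hmem ((proj Q)⁻¹ * y * proj Q)).1 (h ▸ Subgroup.mem_top _)
    simpa [mul_assoc] using this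
  · refine Or.inr ⟨((A 0 0 - A 1 1) / 2, A 1 0), fun h => hc (congrArg Prod.snd h), fun y hy => ?_⟩
    obtain ⟨B, rfl⟩ := proj_surjective y
    have hB : proj (Q⁻¹ * B * Q) ∈ lineStab (1, 0) := h (by rw [hmem]; simpa [mul_assoc] using hy)
    rw [proj_mem_lineStab] at hB ⊢
    exact hB.of_conj

end SLTwo
end

section
variable {G : Type*} [Group G]

theorem IsIrred.injective {n : ℕ} {g : Fin n → G} (hg : IsGenSeq g) (h : IsIrred g) :
    Function.Injective g := by
  intro i j hij
  by_contra hne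
  refine h i ?_
  rw [← hg]
  congr 1
  refine (Set.image_subset_range _ _).antisymm ?_
  rintro _ ⟨k, rfl⟩
  by_cases hk : k = i
  · exact ⟨j, fun h => hne h.symm, by rw [hk, hij]⟩
  · exact ⟨k, hk, rfl⟩

theorem bddAbove_irredLen [Finite G] :
    BddAbove {n | ∃ g : Fin n → G, IsGenSeq g ∧ IsIrred g} := by
  refine ⟨Nat.card G, ?_⟩
  rintro n ⟨g, h₁, h₂⟩
  simpa using Nat.card_le_card_of_injective g (h₂.injective h₁)

theorem le_maxIrredLen [Finite G] {n : ℕ} {g : Fin n → G} (h₁ : IsGenSeq g) (h₂ : IsIrred g) :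
    n ≤ maxIrredLen G :=
  le_csSup bddAbove_irredLen ⟨g, h₁, h₂⟩

theorem closure_pair_ne_top [IsSimpleGroup G] (hG : ∃ a b : G, a * b ≠ b * a) {x y : G}
    (hx : x ^ 2 = 1) (hy : y ^ 2 = 1) : Subgroup.closure {x, y} ≠ ⊤ := by
  intro h
  obtain ⟨a, b, hab⟩ := hG
  have hx' : x⁻¹ = x := inv_eq_of_mul_eq_one_left (by rw [← pow_two, hx])
  have hy' : y⁻¹ = y := inv_eq_of_mul_eq_one_left (by rw [← pow_two, hy])
  have hn : Subgroup.normalizer (Subgroup.zpowers (x * y) : Set G) = ⊤ := by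
    rw [eq_top_iff, ← h, Subgroup.closure_le]
    have key : ∀ u : G, u⁻¹ = u → u * (x * y) * u⁻¹ = (x * y)⁻¹ →
        u ∈ Subgroup.normalizer (Subgroup.zpowers (x * y) : Set G) := by
      intro u hu hu'
      have hc : ∀ z ∈ Subgroup.zpowers (x * y), u * z * u⁻¹ ∈ Subgroup.zpowers (x * y) := by
        rintro _ ⟨k, rfl⟩
        refine ⟨-k, ?_⟩
        simp only [← conj_zpow, hu', inv_zpow', zpow_neg]
      rw [Subgroup.mem_normalizer_iff]
      refine fun z => ⟨hc z, fun hz => ?_⟩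
      have := hc _ hz
      rw [hu] at this
      have h2 : u * u = 1 := by
        nth_rewrite 1 [← hu]; exact inv_mul_cancel u
      rwa [show u * (u * z * u) * u = (u * u) * z * (u * u) by group, h2, one_mul, mul_one] at this
    rintro u (rfl | rfl)
    · exact key u hx' (by rw [mul_inv_rev, hy', hx', ← mul_assoc, ← pow_two, hx, one_mul])
    · exact key u hy' (by
        rw [mul_inv_rev, hx', hy', ← mul_assoc, mul_assoc, ← pow_two, hy, mul_one])
  have hN : (Subgroup.zpowers (x * y)).Normal := Subgroup.normalizer_eq_top_iff.1 hn
  rcases hN.eq_bot_or_eq_top with h' | h'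
  · rw [Subgroup.zpowers_eq_bot] at h'
    obtain rfl : x = y := by rw [← hx', inv_eq_of_mul_eq_one_right h']
    rw [Set.pair_eq_singleton, ← Subgroup.zpowers_eq_closure] at h
    obtain ⟨k, rfl⟩ : a ∈ Subgroup.zpowers x := h ▸ Subgroup.mem_top a
    obtain ⟨l, rfl⟩ : b ∈ Subgroup.zpowers x := h ▸ Subgroup.mem_top b
    exact hab (by simp only [← zpow_add, add_comm])
  · obtain ⟨k, rfl⟩ : a ∈ Subgroup.zpowers (x * y) := h' ▸ Subgroup.mem_top a
    obtain ⟨l, rfl⟩ : b ∈ Subgroup.zpowers (x * y) := h' ▸ Subgroup.mem_top b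
    exact hab (by simp only [← zpow_add, add_comm])

theorem three_le_maxIrredLen [Finite G] [IsSimpleGroup G] (hG : ∃ a b : G, a * b ≠ b * a)
    (hinv : ∃ x : G, x ≠ 1 ∧ x ^ 2 = 1) : 3 ≤ maxIrredLen G := by
  classical
  have hS : Subgroup.closure {x : G | x ^ 2 = 1} = ⊤ := by
    have hn : (Subgroup.closure {x : G | x ^ 2 = 1}).Normal := by
      refine Subgroup.normalizer_eq_top_iff.1 (top_le_iff.1 ?_)
      refine le_trans (fun g _ => ?_) (Subgroup.normalizer_le_normalizer_closure _)
      rw [Subgroup.mem_set_normalizer_iff]; simp [conj_pow]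
    refine hn.eq_bot_or_eq_top.resolve_left fun h => ?_
    obtain ⟨x, hx, hx2⟩ := hinv
    rw [Subgroup.closure_eq_bot_iff] at h
    exact hx (h hx2)
  obtain ⟨S, hSm⟩ := (Set.toFinite {S : Set G | S ⊆ {x | x ^ 2 = 1} ∧
    Subgroup.closure S = ⊤}).exists_minimal ⟨_, subset_rfl, hS⟩
  obtain ⟨⟨hS2, hSt⟩, hmin⟩ := hSm
  let e := (Finite.equivFin S).symm
  have hrange : Set.range (fun i => (e i : G)) = S := by
    rw [Set.range_comp' , e.range_eq_univ]; simp
  have hgen : IsGenSeq fun i => (e i : G) := by rw [IsGenSeq, hrange, hSt]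
  have hirr : IsIrred fun i => (e i : G) := by
    intro i hi
    have hsub : (fun i => (e i : G)) '' {j | j ≠ i} ⊆ S := by
      rintro _ ⟨k, -, rfl⟩
      exact (e k).2
    obtain ⟨j, hj, hji⟩ := hmin ⟨hsub.trans hS2, hi⟩ hsub (e i).2
    exact hj (e.injective (Subtype.ext hji))
  refine le_trans ?_ (le_maxIrredLen hgen hirr)
  by_contra! hlt
  have : ∃ x y : G, x ^ 2 = 1 ∧ y ^ 2 = 1 ∧ S ⊆ {x, y} := by
    rw [Nat.card_coe_set_eq] at hlt
    have h3 : S.ncard = 0 ∨ S.ncard = 1 ∨ S.ncard = 2 := by omega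
    rcases h3 with h | h | h
    · rw [Set.ncard_eq_zero] at h
      exact ⟨1, 1, by simp, by simp, by simp [h]⟩
    · obtain ⟨x, rfl⟩ := Set.ncard_eq_one.1 h
      exact ⟨x, x, hS2 rfl, hS2 rfl, by simp⟩
    · obtain ⟨x, y, -, rfl⟩ := Set.ncard_eq_two.1 h
      exact ⟨x, y, hS2 (by simp), hS2 (by simp), subset_rfl⟩
  obtain ⟨x, y, hx, hy, hxy⟩ := this
  exact closure_pair_ne_top hG hx hy (top_le_iff.1 (hSt ▸ Subgroup.closure_mono hxy))

end

section
open Matrix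

namespace SLTwo

section Conj

variable {F : Type*} [Field F]

local notation "SL₂" => Matrix.SpecialLinearGroup (Fin 2) F
local notation "PSL₂" => Matrix.ProjectiveSpecialLinearGroup (Fin 2) F

/-- Conjugation by an invertible matrix, as an automorphism of `SL₂`. -/
def conjAut (u : (Matrix (Fin 2) (Fin 2) F)ˣ) : SL₂ ≃* SL₂ where
  toFun A := ⟨u * (A : Matrix (Fin 2) (Fin 2) F) * (↑u⁻¹ : Matrix (Fin 2) (Fin 2) F), by
    rw [Matrix.det_units_conj, A.2]⟩
  invFun A := ⟨(↑u⁻¹ : Matrix (Fin 2) (Fin 2) F) * (A : Matrix (Fin 2) (Fin 2) F) * u, by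
    rw [Matrix.det_units_conj', A.2]⟩
  left_inv A := Subtype.ext (by simp [mul_assoc])
  right_inv A := Subtype.ext (by simp [mul_assoc])
  map_mul' A B := Subtype.ext (by
    change (u : Matrix (Fin 2) (Fin 2) F) * (A * B) * (↑u⁻¹ : Matrix (Fin 2) (Fin 2) F) =
      u * A * (↑u⁻¹ : Matrix (Fin 2) (Fin 2) F) * (u * B * (↑u⁻¹ : Matrix (Fin 2) (Fin 2) F))
    simp [mul_assoc])

theorem coe_conjAut_mul (u : (Matrix (Fin 2) (Fin 2) F)ˣ) (A : SL₂) :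
    (conjAut u A : Matrix (Fin 2) (Fin 2) F) * u = u * (A : Matrix (Fin 2) (Fin 2) F) :=
  Units.inv_mul_cancel_right _ _

theorem conjAut_eq_of_mul_eq {u : (Matrix (Fin 2) (Fin 2) F)ˣ} {A B : SL₂}
    (h : (B : Matrix (Fin 2) (Fin 2) F) * u = u * (A : Matrix (Fin 2) (Fin 2) F)) :
    conjAut u A = B :=
  Subtype.ext (u.isUnit.mul_left_injective ((coe_conjAut_mul u A).trans h.symm))

/-- The automorphism of `PSL₂` induced by conjugation by an invertible matrix. -/
def projConjAut (u : (Matrix (Fin 2) (Fin 2) F)ˣ) : PSL₂ ≃* PSL₂ :=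
  QuotientGroup.congr _ _ (conjAut u)
    (Subgroup.characteristic_iff_map_eq.1 inferInstance (conjAut u))

theorem projConjAut_proj (u : (Matrix (Fin 2) (Fin 2) F)ˣ) (A : SL₂) :
    projConjAut u (proj A) = proj (conjAut u A) :=
  rfl

theorem tr_eq_trace (A : SL₂) : tr A = Matrix.trace (A : Matrix (Fin 2) (Fin 2) F) :=
  (Matrix.trace_fin_two _).symm

theorem coe_inv_eq (A : SL₂) :
    ((A⁻¹ : SL₂) : Matrix (Fin 2) (Fin 2) F) = tr A • (1 : Matrix (Fin 2) (Fin 2) F) - A := by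
  ext i j
  fin_cases i <;> fin_cases j <;> simp [inv_00, inv_01, inv_10, inv_11, tr]

theorem coe_eq_smul_of_proj_eq {A B : SL₂} (h : proj A = proj B) :
    ∃ e : F, (e = 1 ∨ e = -1) ∧
      (B : Matrix (Fin 2) (Fin 2) F) = e • (A : Matrix (Fin 2) (Fin 2) F) := by
  obtain ⟨e, he, h⟩ := exists_sign_of_proj_eq h
  exact ⟨e, he, Matrix.ext h⟩

theorem tr_sq_eq_four_of_fixesLine {A B : SL₂} (h : B * A * B⁻¹ = A⁻¹) {v : F × F} (hv : v ≠ 0)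
    (hA : FixesLine v A) (hB : FixesLine v B) : tr A ^ 2 = 4 := by
  obtain ⟨k, hk₁, hk₂⟩ := hA
  obtain ⟨l, hl₁, hl₂⟩ := hB
  have hk := FixesLine.charpoly_eq_zero hv hk₁ hk₂
  have hl := FixesLine.charpoly_eq_zero hv hl₁ hl₂
  have hl0 : l ≠ 0 := by rintro rfl; simp at hl
  have h' : B * A = A⁻¹ * B := by rw [← h]; group
  have h₀₀ := congrArg (fun M : SL₂ => M 0 0) h'
  have h₀₁ := congrArg (fun M : SL₂ => M 0 1) h'
  have h₁₀ := congrArg (fun M : SL₂ => M 1 0) h'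
  have h₁₁ := congrArg (fun M : SL₂ => M 1 1) h'
  simp only [mul_00, mul_01, mul_10, mul_11, inv_00, inv_01, inv_10, inv_11] at h₀₀ h₀₁ h₁₀ h₁₁
  have e₁ : l * (tr A - 2 * k) * v.1 = 0 := by
    simp only [tr]
    linear_combination -(v.1 * h₀₀ + v.2 * h₀₁) + (B 0 0 * hk₁ + B 0 1 * hk₂ + k * hl₁) -
      (A 1 1 * hl₁ - A 0 1 * hl₂ - l * hk₁)
  have e₂ : l * (tr A - 2 * k) * v.2 = 0 := by
    simp only [tr]
    linear_combination -(v.1 * h₁₀ + v.2 * h₁₁) + (B 1 0 * hk₁ + B 1 1 * hk₂ + k * hl₂) -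
      (A 0 0 * hl₂ - A 1 0 * hl₁ - l * hk₂)
  have ht : tr A = 2 * k := by
    by_contra hne
    have hc := mul_ne_zero hl0 (sub_ne_zero.2 hne)
    exact hv (Prod.ext ((mul_eq_zero.1 e₁).resolve_left hc) ((mul_eq_zero.1 e₂).resolve_left hc))
  rw [ht] at hk ⊢
  linear_combination -4 * hk

/-- A unit of the matrix ring inverting `H` up to sign and centralizing `A`, for `A` of order `3`
in `PSL₂` inverted by `H`. -/
theorem exists_unit_of_conj_eq_inv {A H : SL₂} (h3 : (3 : F) ≠ 0) (ht : tr A ^ 2 = 1)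
    (h : H * A * H⁻¹ = A⁻¹) :
    ∃ u : (Matrix (Fin 2) (Fin 2) F)ˣ,
      (u : Matrix (Fin 2) (Fin 2) F) = (2 : F) • (A : Matrix (Fin 2) (Fin 2) F) - tr A • 1 ∧
      (u : Matrix (Fin 2) (Fin 2) F) * u = (-3 : F) • 1 ∧
      (H : Matrix (Fin 2) (Fin 2) F) * u = -(u * (H : Matrix (Fin 2) (Fin 2) F)) := by
  set W : Matrix (Fin 2) (Fin 2) F := (2 : F) • (A : Matrix (Fin 2) (Fin 2) F) - tr A • 1 with hW
  have hWW : W * W = (-3 : F) • 1 := by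
    have := coe_sq A
    rw [pow_two] at this
    have e : W * W = (4 : F) • ((A : Matrix (Fin 2) (Fin 2) F) * A) -
        (4 * tr A) • (A : Matrix (Fin 2) (Fin 2) F) + (tr A ^ 2) • 1 := by
      rw [hW]
      simp only [sub_mul, mul_sub, smul_mul_assoc, mul_smul_comm, one_mul, mul_one]
      module
    rw [e, this, ht]
    module
  refine ⟨⟨W, (-3 : F)⁻¹ • W, ?_, ?_⟩, rfl, hWW, ?_⟩
  · rw [mul_smul_comm, hWW, smul_smul, inv_mul_cancel₀ (neg_ne_zero.2 h3), one_smul]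
  · rw [smul_mul_assoc, hWW, smul_smul, inv_mul_cancel₀ (neg_ne_zero.2 h3), one_smul]
  · have h' : (H : Matrix (Fin 2) (Fin 2) F) * A =
        (tr A • 1 - (A : Matrix (Fin 2) (Fin 2) F)) * H := by
      rw [← coe_inv_eq, ← Matrix.SpecialLinearGroup.coe_mul, ← Matrix.SpecialLinearGroup.coe_mul,
        ← h, inv_mul_cancel_right]
    change (H : Matrix (Fin 2) (Fin 2) F) * W = -(W * H)
    rw [hW, mul_sub, mul_smul_comm, h']
    simp only [sub_mul, smul_mul_assoc, mul_smul_comm, one_mul, mul_one, smul_sub, smul_smul]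
    module

end Conj

end SLTwo

end

section
open Matrix

namespace SLTwo

section Subgroups

variable {F : Type*} [Field F]

local notation "PSL₂" => Matrix.ProjectiveSpecialLinearGroup (Fin 2) F

theorem mem_normalizer_torus {x y : PSL₂} (hx : x ≠ 1) :
    y ∈ Subgroup.normalizer (torus x : Set PSL₂) ↔ y * x * y⁻¹ ∈ torus x :=
  torus_isConjPartition.mem_normalizer_iff hx

theorem torus_le_normalizer (x : PSL₂) : torus x ≤ Subgroup.normalizer (torus x : Set PSL₂) :=
  Subgroup.le_normalizer

theorem torus_eq {x y : PSL₂} (hx : x ≠ 1) (hy : y ≠ 1) (h : y ∈ torus x) : torus y = torus x :=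
  torus_isConjPartition.eq_of_mem x y hx hy h

theorem self_mem_torus (x : PSL₂) : x ∈ torus x := torus_isConjPartition.self_mem x

theorem IsRegular.mem_normalizer_subTorus {K : Subgroup PSL₂} (hK : IsRegular K)
    (h2 : (2 : F) ≠ 0) {x y : K}
    (hx : x ≠ 1) : y ∈ Subgroup.normalizer (subTorus K x : Set K) ↔
      (y * x * y⁻¹ : PSL₂) ∈ torus (x : PSL₂) := by
  rw [(hK.isToralPartition h2).mem_normalizer_iff hx, mem_subTorus]
  rfl

theorem IsRegular.le_normalizer_torus {K : Subgroup PSL₂} (hK : IsRegular K)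
    (h2 : (2 : F) ≠ 0) {x : K} (hx : x ≠ 1)
    (hn : Subgroup.normalizer (subTorus K x : Set K) = ⊤) {g : PSL₂} (hg : g ∈ K) (hg1 : g ≠ 1)
    (hg2 : g ^ 2 ≠ 1) : K ≤ Subgroup.normalizer (torus g : Set PSL₂) := by
  have hx' : (x : PSL₂) ≠ 1 := fun h => hx (Subtype.ext h)
  have key : ∀ y ∈ K, (y * x * y⁻¹ : PSL₂) ∈ torus (x : PSL₂) := fun y hy =>
    (hK.mem_normalizer_subTorus h2 (y := ⟨y, hy⟩) hx).1 (hn ▸ Subgroup.mem_top _)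
  have hgx : g ∈ torus (x : PSL₂) := by
    by_contra hgx
    exact hg2 (sq_eq_one_of_not_mem_torus h2 hx' (hK x x.2 hx') (key g hg) hgx).2
  intro y hy
  rw [torus_eq hx' hg1 hgx, mem_normalizer_torus hx']
  exact key y hy

theorem IsRegular.exists_conj_mem_of_card_ne {K : Subgroup PSL₂} (hK : IsRegular K) [Finite K]
    (h2 : (2 : F) ≠ 0)
    {x : K} (hx : x ≠ 1) (h : Nat.card (Subgroup.normalizer (subTorus K x : Set K)) ≠
      Nat.card (subTorus K x)) :
    ∃ y ∈ K, (y * x * y⁻¹ : PSL₂) ∈ torus (x : PSL₂) ∧ y ∉ torus (x : PSL₂) := by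
  by_contra! hcon
  refine h (congrArg (fun H : Subgroup K => Nat.card H) (le_antisymm (fun y hy => ?_)
    Subgroup.le_normalizer))
  exact hcon y y.2 ((hK.mem_normalizer_subTorus h2 hx).1 hy)

theorem IsRegular.mem_torus_of_card_eq {K : Subgroup PSL₂} (hK : IsRegular K) [Finite K]
    (h2 : (2 : F) ≠ 0)
    {x : K} (hx : x ≠ 1) (h : Nat.card (Subgroup.normalizer (subTorus K x : Set K)) =
      Nat.card (subTorus K x)) {y : PSL₂} (hy : y ∈ K)
    (hyx : (y * x * y⁻¹ : PSL₂) ∈ torus (x : PSL₂)) : y ∈ torus (x : PSL₂) := by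
  have he : subTorus K x = Subgroup.normalizer (subTorus K x : Set K) :=
    Subgroup.eq_of_le_of_card_ge Subgroup.le_normalizer h.le
  have : (⟨y, hy⟩ : K) ∈ subTorus K x :=
    he ▸ (hK.mem_normalizer_subTorus h2 (y := ⟨y, hy⟩) hx).2 hyx
  exact mem_subTorus.1 this

theorem orderOf_dvd_card_subTorus {K : Subgroup PSL₂} {x y : PSL₂} (hx : x ∈ K) (hy : y ∈ K)
    (h : y ∈ torus x) : orderOf y ∣ Nat.card (subTorus K ⟨x, hx⟩) := by
  have := Subgroup.orderOf_dvd_natCard (subTorus K ⟨x, hx⟩) (x := ⟨y, hy⟩) (mem_subTorus.2 h)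
  rwa [Subgroup.orderOf_mk] at this

theorem mem_zpowers_of_card_eq {K : Subgroup PSL₂} [Finite K] {x y : PSL₂} (hx : x ∈ K)
    (hy : y ∈ K) (h : y ∈ torus x) (hc : Nat.card (subTorus K ⟨x, hx⟩) = orderOf x) :
    y ∈ Subgroup.zpowers x := by
  have he : Subgroup.zpowers (⟨x, hx⟩ : K) = subTorus K ⟨x, hx⟩ := by
    refine Subgroup.eq_of_le_of_card_ge ?_ ?_
    · rw [Subgroup.zpowers_le]
      exact mem_subTorus.2 (self_mem_torus x)
    · rw [Nat.card_zpowers, hc, Subgroup.orderOf_mk]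
  have : (⟨y, hy⟩ : K) ∈ Subgroup.zpowers (⟨x, hx⟩ : K) := he ▸ mem_subTorus.2 h
  obtain ⟨k, hk⟩ := this
  exact ⟨k, congrArg Subtype.val hk⟩

theorem not_le_lineStab {K : Subgroup PSL₂} {g h : PSL₂} (h2 : (2 : F) ≠ 0) (hg1 : g ≠ 1)
    (hgt : trsq g ≠ 4)
    (hh : h * g * h⁻¹ ∈ torus g) (hh' : h ∉ torus g) (hgK : g ∈ K) (hhK : h ∈ K) {v : F × F}
    (hv : v ≠ 0) : ¬ K ≤ lineStab v := by
  intro hK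
  obtain ⟨A, rfl⟩ := proj_surjective g
  obtain ⟨B, rfl⟩ := proj_surjective h
  have hA : ¬ IsScalar A := fun h => hg1 (proj_eq_one_iff.2 h)
  rw [trsq_proj] at hgt
  exact hgt (tr_sq_eq_four_of_fixesLine (conj_eq_inv h2 hA hgt hh hh') hv
    (proj_mem_lineStab.1 (hK hgK)) (proj_mem_lineStab.1 (hK hhK)))

end Subgroups

section Prime

variable {p : ℕ} [Fact p.Prime]

local notation "PSL₂" => Matrix.ProjectiveSpecialLinearGroup (Fin 2) (ZMod p)

theorem natCast_ne_zero_of_lt {k : ℕ} (hk : k ≠ 0) (hp : k < p) : (k : ZMod p) ≠ 0 := by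
  rw [Ne, ZMod.natCast_eq_zero_iff]
  exact fun h => absurd (Nat.le_of_dvd (Nat.pos_of_ne_zero hk) h) (not_le.2 hp)

theorem isRegular_or_le_lineStab (h2 : (2 : ZMod p) ≠ 0) {K : Subgroup PSL₂} (hK : K ≠ ⊤) :
    IsRegular K ∨ ∃ v, v ≠ 0 ∧ K ≤ lineStab v := by
  rw [or_iff_not_imp_left]
  intro h
  unfold IsRegular at h
  push Not at h
  obtain ⟨x, hxK, hx1, hx4⟩ := h
  exact (eq_top_or_exists_le_lineStab h2 hxK hx1 hx4).resolve_left hK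

/-- The subgroup `K` is isomorphic to a rotation group of a regular polyhedron, expressed through
the orders of the tori of its elements and of their normalizers. -/
def IsPolyhedral {F : Type*} [Field F]
    (K : Subgroup (Matrix.ProjectiveSpecialLinearGroup (Fin 2) F)) : Prop :=
  IsToralPartition.IsTetrahedral (subTorus K) ∨ IsToralPartition.IsOctahedral (subTorus K) ∨
    IsToralPartition.IsIcosahedral (subTorus K)

theorem IsPolyhedral.card {F : Type*} [Field F]
    {K : Subgroup (Matrix.ProjectiveSpecialLinearGroup (Fin 2) F)} (hK : IsPolyhedral K) :
    Nat.card K = 12 ∨ Nat.card K = 24 ∨ Nat.card K = 60 :=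
  hK.imp And.left (Or.imp And.left And.left)

theorem IsRegular.le_normalizer_torus_or_isPolyhedral {F : Type*} [Field F] [Finite F]
    {K : Subgroup (Matrix.ProjectiveSpecialLinearGroup (Fin 2) F)} (hK : IsRegular K)
    (h2 : (2 : F) ≠ 0) {g : Matrix.ProjectiveSpecialLinearGroup (Fin 2) F} (hg : g ∈ K)
    (hg1 : g ≠ 1) (hg2 : g ^ 2 ≠ 1) :
    K ≤ Subgroup.normalizer (torus g : Set (Matrix.ProjectiveSpecialLinearGroup (Fin 2) F)) ∨
      IsPolyhedral K := by
  have : Nontrivial K := ⟨⟨⟨g, hg⟩, 1, fun h => hg1 (congrArg Subtype.val h)⟩⟩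
  exact (hK.isToralPartition h2).classification.imp_left
    fun ⟨x, hx, hn⟩ => hK.le_normalizer_torus h2 hx hn hg hg1 hg2

theorem isOctahedral_or_isIcosahedral (h2 : (2 : ZMod p) ≠ 0) {K : Subgroup PSL₂} (hK : K ≠ ⊤)
    {g h a : PSL₂} (hg1 : g ≠ 1) (hgt : trsq g ≠ 4) (hg3 : orderOf g = 3)
    (hh : h * g * h⁻¹ ∈ torus g) (hh' : h ∉ torus g) (ha : a * g * a⁻¹ ∉ torus g) (hgK : g ∈ K)
    (hhK : h ∈ K) (haK : a ∈ K) :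
    IsToralPartition.IsOctahedral (subTorus K) ∨ IsToralPartition.IsIcosahedral (subTorus K) := by
  have hreg : IsRegular K := (isRegular_or_le_lineStab h2 hK).resolve_right
    fun ⟨v, hv, hKv⟩ => not_le_lineStab h2 hg1 hgt hh hh' hgK hhK hv hKv
  have hg1' : (⟨g, hgK⟩ : K) ≠ 1 := fun h => hg1 (congrArg Subtype.val h)
  have hg2 : g ^ 2 ≠ 1 := fun h => by
    have := orderOf_dvd_of_pow_eq_one h
    rw [hg3] at this
    omega
  refine ((hreg.le_normalizer_torus_or_isPolyhedral h2 hgK hg1 hg2).resolve_left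
    fun hn => ha ((mem_normalizer_torus hg1).1 (hn haK))).resolve_left fun hT => hh' ?_
  refine hreg.mem_torus_of_card_eq h2 hg1' ?_ hhK hh
  rcases hT.2 _ hg1' with ⟨h₁, -⟩ | ⟨h₁, h₂⟩
  · have := orderOf_dvd_card_subTorus hgK hgK (self_mem_torus g)
    rw [h₁, hg3] at this
    omega
  · rw [h₁, h₂]

end Prime
end SLTwo

end

section
variable {G : Type*} [Group G]

theorem not_isGenSeq_of_forall_mem {n : ℕ} {s : Fin n → G} {K : Subgroup G} (hK : K ≠ ⊤)
    (h : ∀ j, s j ∈ K) : ¬ IsGenSeq s := fun hs =>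
  hK (top_le_iff.1 (hs ▸ (Subgroup.closure_le K).2 (Set.range_subset_iff.2 h)))

theorem closure_image_ne_top {n : ℕ} {s : Fin n → G} {K : Subgroup G} (hK : K ≠ ⊤) {i : Fin n}
    (h : ∀ j, j ≠ i → s j ∈ K) : Subgroup.closure (s '' {j | j ≠ i}) ≠ ⊤ := fun hs =>
  hK (top_le_iff.1 (hs ▸ (Subgroup.closure_le K).2 (by rintro _ ⟨j, hj, rfl⟩; exact h j hj)))

theorem isWitnessToFailure_of_maxIrredLen_eq_three [Finite G] (hm : maxIrredLen G = 3)
    {g a b h : G} (h1 : h ≠ 1) (hgen : Subgroup.closure {g, a, b, h} = ⊤) {K₁ K₂ K₃ : Subgroup G}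
    (hK₁ : K₁ ≠ ⊤) (hK₂ : K₂ ≠ ⊤) (hK₃ : K₃ ≠ ⊤) (h₁ : a ∈ K₁ ∧ b ∈ K₁ ∧ h ∈ K₁)
    (h₂ : g ∈ K₂ ∧ b ∈ K₂ ∧ h ∈ K₂) (h₃ : g ∈ K₃ ∧ a ∈ K₃ ∧ h ∈ K₃) : IsWitnessToFailure h := by
  obtain ⟨ha₁, hb₁, hh₁⟩ := h₁
  obtain ⟨hg₂, hb₂, hh₂⟩ := h₂
  obtain ⟨hg₃, ha₃, hh₃⟩ := h₃
  have hgab : IsGenSeq ![g, a, b] := by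
    by_contra hne
    have h4 : 4 ≤ maxIrredLen G := by
      refine le_maxIrredLen (g := ![g, a, b, h]) ?_ fun i => ?_
      · rw [IsGenSeq, ← hgen]
        simp [Matrix.range_cons]
        congr 1
        ext x
        simp
        tauto
      · fin_cases i
        · exact closure_image_ne_top hK₁ (by intro j hj; fin_cases j <;> simp_all)
        · exact closure_image_ne_top hK₂ (by intro j hj; fin_cases j <;> simp_all)
        · exact closure_image_ne_top hK₃ (by intro j hj; fin_cases j <;> simp_all)
        · refine closure_image_ne_top hne ?_
          intro j hj
          refine Subgroup.subset_closure ?_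
          fin_cases j <;> simp_all [Matrix.range_cons]
    omega
  have key : ∀ n, n = 3 → ∃ s : Fin n → G, IsGenSeq s ∧ IsIrred s ∧
      ∀ i, ¬ IsGenSeq (Function.update s i h) := by
    rintro _ rfl
    refine ⟨![g, a, b], hgab, fun i => ?_, fun i => ?_⟩
    · fin_cases i
      · exact closure_image_ne_top hK₁ (by intro j hj; fin_cases j <;> simp_all)
      · exact closure_image_ne_top hK₂ (by intro j hj; fin_cases j <;> simp_all)
      · exact closure_image_ne_top hK₃ (by intro j hj; fin_cases j <;> simp_all)
    · fin_cases i
      · exact not_isGenSeq_of_forall_mem hK₁ (by intro j; fin_cases j <;> simpa [Function.update])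
      · exact not_isGenSeq_of_forall_mem hK₂ (by intro j; fin_cases j <;> simpa [Function.update])
      · exact not_isGenSeq_of_forall_mem hK₃ (by intro j; fin_cases j <;> simpa [Function.update])
  exact ⟨h1, key _ hm⟩

end

section
open Matrix

namespace SLTwo

section Companions

variable {F : Type*} [Field F]

local notation "PSL₂" => Matrix.ProjectiveSpecialLinearGroup (Fin 2) F

theorem conj_eq_self_of_sq_eq_one {h a : PSL₂} (h2 : (2 : F) ≠ 0) (hh1 : h ≠ 1)
    (hh : h ^ 2 = 1) (ht : trsq h ≠ 4) (ha : a * h * a⁻¹ ∈ torus h) : a * h * a⁻¹ = h := by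
  have hinv : h⁻¹ = h := inv_eq_of_mul_eq_one_left (by rw [← pow_two, hh])
  obtain ⟨H, rfl⟩ := proj_surjective h
  obtain ⟨A, rfl⟩ := proj_surjective a
  rw [trsq_proj] at ht
  rcases conj_eq_or_eq_inv h2 (fun h => hh1 (proj_eq_one_iff.2 h)) ht ha with h' | h'
  · rw [← map_inv, ← map_mul, ← map_mul, h']
  · rw [← map_inv, ← map_mul, ← map_mul, h', map_inv, hinv]

/-- In an icosahedral subgroup, an element `g` of order three is inverted by an involution `h`,
which commutes with an involution `a` not normalizing the torus of `g`. -/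
theorem exists_involutions_of_isIcosahedral [Finite F] {M : Subgroup PSL₂} (hM : IsRegular M)
    (hI : IsToralPartition.IsIcosahedral (subTorus M)) (h2 : (2 : F) ≠ 0) {g : PSL₂}
    (hg : g ∈ M) (hg3 : orderOf g = 3) :
    ∃ h a, ∃ hhM : h ∈ M, a ∈ M ∧ h ≠ 1 ∧ h ^ 2 = 1 ∧ h * g * h⁻¹ ∈ torus g ∧ h ∉ torus g ∧
      a ^ 2 = 1 ∧ a ∉ torus h ∧ a * h * a⁻¹ = h ∧ a * g * a⁻¹ ∉ torus g ∧
      Nat.card (subTorus M ⟨h, hhM⟩) = 2 := by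
  have hmk : ∀ {x : PSL₂} (hx : x ∈ M), x ≠ 1 → (⟨x, hx⟩ : M) ≠ 1 :=
    fun _ hx1 h => hx1 (congrArg Subtype.val h)
  have hg1 : g ≠ 1 := by rintro rfl; simp at hg3
  obtain ⟨hcg, hng⟩ := hI.2 _ (hmk hg hg1)
  have hdg := orderOf_dvd_card_subTorus hg hg (self_mem_torus g)
  rw [hg3] at hdg
  have hcg3 : Nat.card (subTorus M ⟨g, hg⟩) = 3 := by
    rcases hcg with h | h | h <;> rw [h] at hdg ⊢ <;> omega
  obtain ⟨h, hhM, hh, hh'⟩ := hM.exists_conj_mem_of_card_ne h2 (hmk hg hg1)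
    (by rw [hng, hcg3]; norm_num)
  obtain ⟨hht, hh2⟩ := sq_eq_one_of_not_mem_torus h2 hg1 (hM g hg hg1) hh hh'
  have hh1 : h ≠ 1 := by rintro rfl; exact hh' (one_mem _)
  obtain ⟨hch, hnh⟩ := hI.2 _ (hmk hhM hh1)
  have hdh := orderOf_dvd_card_subTorus hhM hhM (self_mem_torus h)
  rw [orderOf_eq_prime hh2 hh1] at hdh
  have hch2 : Nat.card (subTorus M ⟨h, hhM⟩) = 2 := by
    rcases hch with h | h | h <;> rw [h] at hdh ⊢ <;> omega
  obtain ⟨a, haM, ha, ha'⟩ := hM.exists_conj_mem_of_card_ne h2 (hmk hhM hh1)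
    (by rw [hnh, hch2]; norm_num)
  obtain ⟨-, ha2⟩ := sq_eq_one_of_not_mem_torus h2 hh1 (hM h hhM hh1) ha ha'
  have hah := conj_eq_self_of_sq_eq_one h2 hh1 hh2 (hM h hhM hh1) ha
  have hcomm : a * h = h * a := by rw [← mul_inv_eq_iff_eq_mul, hah]
  have hodd : ∀ x ∈ M, x ^ 2 = 1 → x ∈ torus g → x = 1 := by
    intro x hx hx2 hxg
    have h3 := orderOf_dvd_card_subTorus hg hx hxg
    rw [hcg3] at h3
    exact orderOf_eq_one_iff.1 (Nat.dvd_one.1 ((Nat.dvd_gcd (orderOf_dvd_of_pow_eq_one hx2) h3)))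
  refine ⟨h, a, hhM, haM, hh1, hh2, hh, hh', ha2, ha', hah, fun hag => ?_, hch2⟩
  by_cases hatg : a ∈ torus g
  · exact ha' (hodd a haM ha2 hatg ▸ one_mem _)
  · have hmem := mul_mem_torus h2 hg1 (hM g hg hg1) hag hh hatg hh'
    have h1 := hodd (a * h) (mul_mem haM hhM)
      (by rw [(show Commute a h from hcomm).mul_pow, ha2, hh2, one_mul]) hmem
    rw [mul_eq_one_iff_eq_inv] at h1
    exact ha' (h1 ▸ inv_mem (self_mem_torus h))

theorem trsq_of_isIcosahedral {M : Subgroup PSL₂}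
    (hI : IsToralPartition.IsIcosahedral (subTorus M)) {y : PSL₂} (hy : y ∈ M) :
    trsq y = 4 ∨ trsq y = 0 ∨ trsq y = 1 ∨ trsq y ^ 2 - 3 * trsq y + 1 = 0 := by
  by_cases hy1 : y = 1
  · exact .inl (hy1 ▸ trsq_one)
  obtain ⟨hc, -⟩ := hI.2 ⟨y, hy⟩ fun h => hy1 (congrArg Subtype.val h)
  have hd := orderOf_dvd_card_subTorus hy hy (self_mem_torus y)
  rw [orderOf_dvd_iff_pow_eq_one] at hd
  rcases hc with h | h | h <;> rw [h] at hd
  · exact .inr (.inl (trsq_of_sq_eq_one hy1 hd))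
  · exact .inr (.inr (.inl (trsq_of_cube_eq_one hy1 hd)))
  · exact .inr (.inr (.inr (trsq_of_pow_five_eq_one hy1 hd)))

end Companions

section Matrices

variable {F : Type*} [Field F]

local notation "SL₂" => Matrix.SpecialLinearGroup (Fin 2) F

theorem conj_mem_torus_of_proj_conjAut_eq {A B : SL₂} {u : (Matrix (Fin 2) (Fin 2) F)ˣ}
    (h2 : (2 : F) ≠ 0)
    (hu : (u : Matrix (Fin 2) (Fin 2) F) = (2 : F) • (A : Matrix (Fin 2) (Fin 2) F) - tr A • 1)
    (h : proj (conjAut u B) = proj B) : proj B * proj A * (proj B)⁻¹ ∈ torus (proj A) := by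
  obtain ⟨e, he, h⟩ := coe_eq_smul_of_proj_eq h.symm
  have h' := coe_conjAut_mul u B
  rw [h, smul_mul_assoc, hu] at h'
  have key : ∀ C : SL₂, (2 : F) • ((B : Matrix (Fin 2) (Fin 2) F) * A) =
      (2 : F) • ((C : Matrix (Fin 2) (Fin 2) F) * B) → B * A * B⁻¹ = C := by
    intro C hC
    rw [mul_inv_eq_iff_eq_mul]
    refine Subtype.ext (smul_right_injective _ h2 ?_)
    simpa using hC
  rw [← map_inv, ← map_mul, ← map_mul, proj_mem_torus]
  rcases he with rfl | rfl
  · rw [key A]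
    rw [one_smul, mul_sub, sub_mul, mul_smul_comm, mul_smul_comm, smul_mul_assoc, smul_mul_assoc,
      one_mul, mul_one, sub_left_inj] at h'
    exact h'
  · rw [key A⁻¹, mul_inv_cancel, inv_mul_cancel]
    rw [coe_inv_eq]
    simp only [mul_sub, sub_mul, mul_smul_comm, smul_mul_assoc, one_mul, mul_one] at h' ⊢
    linear_combination (norm := module) (-1 : F) • h'

theorem trsq_of_proj_conjAut_eq {A B H : SL₂} {u : (Matrix (Fin 2) (Fin 2) F)ˣ}
    (h2 : (2 : F) ≠ 0) (ht : tr A ^ 2 = 1)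
    (hu : (u : Matrix (Fin 2) (Fin 2) F) = (2 : F) • (A : Matrix (Fin 2) (Fin 2) F) - tr A • 1)
    (huu : (u : Matrix (Fin 2) (Fin 2) F) * u = (-3 : F) • 1)
    (hH : (H : Matrix (Fin 2) (Fin 2) F) * u = -(u * (H : Matrix (Fin 2) (Fin 2) F)))
    (hHt : tr H = 0)
    (h : proj (conjAut u B) = proj (B * H)) : 4 * trsq (proj (A * (B⁻¹ * A * B))) = 1 := by
  obtain ⟨e, he, h⟩ := coe_eq_smul_of_proj_eq h.symm
  have h' := coe_conjAut_mul u B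
  rw [h, Matrix.SpecialLinearGroup.coe_mul, smul_mul_assoc] at h'
  set U : Matrix (Fin 2) (Fin 2) F := ↑u
  have hA : (2 : F) • (A : Matrix (Fin 2) (Fin 2) F) = U + tr A • 1 := by rw [hu]; module
  have hB : ((B⁻¹ : SL₂) : Matrix (Fin 2) (Fin 2) F) * B = 1 := by
    rw [← Matrix.SpecialLinearGroup.coe_mul, inv_mul_cancel, Matrix.SpecialLinearGroup.coe_one]
  have hBA : (2 : F) • ((B⁻¹ * A * B : SL₂) : Matrix (Fin 2) (Fin 2) F) =
      e • ((H : Matrix (Fin 2) (Fin 2) F) * U) + tr A • 1 := by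
    rw [Matrix.SpecialLinearGroup.coe_mul, Matrix.SpecialLinearGroup.coe_mul, ← smul_mul_assoc,
      ← mul_smul_comm, hA, mul_assoc, add_mul, ← h', mul_add, smul_mul_assoc, one_mul,
      mul_smul_comm, mul_smul_comm, hB, mul_assoc, ← mul_assoc, hB, one_mul]
  have hUH : U * ((H : Matrix (Fin 2) (Fin 2) F) * U) =
      (3 : F) • (H : Matrix (Fin 2) (Fin 2) F) := by
    rw [← mul_assoc, ← neg_eq_iff_eq_neg.2 hH, neg_mul, mul_assoc, huu, mul_smul_comm, mul_one]
    module
  have hprod : (4 : F) • ((A * (B⁻¹ * A * B) : SL₂) : Matrix (Fin 2) (Fin 2) F) =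
      (3 * e) • (H : Matrix (Fin 2) (Fin 2) F) + tr A • U +
        (e * tr A) • ((H : Matrix (Fin 2) (Fin 2) F) * U) + (tr A ^ 2) • 1 := by
    rw [Matrix.SpecialLinearGroup.coe_mul, show (4 : F) = 2 * 2 by norm_num, mul_smul,
      ← mul_smul_comm, ← smul_mul_assoc, hA, hBA, add_mul, mul_add, mul_add, mul_smul_comm, hUH]
    simp only [mul_smul_comm, smul_mul_assoc, mul_one, one_mul]
    module
  have htU : Matrix.trace U = 0 := by
    rw [hu, Matrix.trace_sub, Matrix.trace_smul, Matrix.trace_smul, ← tr_eq_trace,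
      Matrix.trace_one, Fintype.card_fin]
    simp [mul_comm]
  have htHU : Matrix.trace ((H : Matrix (Fin 2) (Fin 2) F) * U) = 0 := by
    have h₁ := congrArg Matrix.trace hH
    rw [Matrix.trace_neg, Matrix.trace_mul_comm U] at h₁
    have h₂ : 2 * Matrix.trace ((H : Matrix (Fin 2) (Fin 2) F) * U) = 0 := by
      linear_combination h₁
    exact (mul_eq_zero.1 h₂).resolve_left h2
  have htr := congrArg Matrix.trace hprod
  rw [Matrix.trace_add, Matrix.trace_add, Matrix.trace_add, Matrix.trace_smul, Matrix.trace_smul,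
    Matrix.trace_smul, Matrix.trace_smul, Matrix.trace_smul, htU, htHU, ← tr_eq_trace,
    ← tr_eq_trace, hHt, ht, Matrix.trace_one, Fintype.card_fin] at htr
  rw [trsq_proj]
  simp only [smul_eq_mul, mul_zero, zero_add, one_mul, Nat.cast_ofNat] at htr
  have h₂ : 2 * tr (A * (B⁻¹ * A * B)) = 1 := mul_left_cancel₀ h2 (by linear_combination htr)
  linear_combination (2 * tr (A * (B⁻¹ * A * B)) + 1) * h₂

end Matrices

end SLTwo

end

section
open Matrix

namespace SLTwo

variable {p : ℕ} [Fact p.Prime]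

local notation "SL₂" => Matrix.SpecialLinearGroup (Fin 2) (ZMod p)
local notation "PSL₂" => Matrix.ProjectiveSpecialLinearGroup (Fin 2) (ZMod p)

theorem two_three_five_ne_zero (hp : 5 < p) :
    (2 : ZMod p) ≠ 0 ∧ (3 : ZMod p) ≠ 0 ∧ (5 : ZMod p) ≠ 0 :=
  ⟨natCast_ne_zero_of_lt (k := 2) (by norm_num) (by omega),
    natCast_ne_zero_of_lt (k := 3) (by norm_num) (by omega),
    natCast_ne_zero_of_lt (k := 5) (by norm_num) (by omega)⟩

theorem four_mul_trsq_ne_one (hp : 5 < p) {M : Subgroup PSL₂}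
    (hI : IsToralPartition.IsIcosahedral (subTorus M)) {y : PSL₂} (hy : y ∈ M) :
    4 * trsq y ≠ 1 := by
  obtain ⟨h2, h3, h5⟩ := two_three_five_ne_zero hp
  intro h
  rcases trsq_of_isIcosahedral hI hy with h' | h' | h' | h'
  · rw [h'] at h
    exact mul_ne_zero h3 h5 (by linear_combination h)
  · rw [h'] at h
    exact one_ne_zero (by linear_combination -h)
  · rw [h'] at h
    exact h3 (by linear_combination h)
  · exact h5 (by linear_combination 16 * h' + (11 - 4 * trsq y) * h)

theorem exists_witness_of_isIcosahedral (hp : 5 < p) (hm : maxIrredLen PSL₂ = 3)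
    {M : Subgroup PSL₂} (hMtop : M ≠ ⊤) (hM : IsRegular M)
    (hI : IsToralPartition.IsIcosahedral (subTorus M)) {g : PSL₂} (hg : g ∈ M)
    (hg3 : orderOf g = 3) : ∃ x : PSL₂, IsWitnessToFailure x ∧ orderOf x = 2 := by
  obtain ⟨h2, h3, h5⟩ := two_three_five_ne_zero hp
  have hg1 : g ≠ 1 := by rintro rfl; simp at hg3
  have hgt : trsq g = 1 := trsq_of_cube_eq_one hg1 (hg3 ▸ pow_orderOf_eq_one g)
  obtain ⟨h, a, hhM, haM, hh1, hh2, hhg, hhg', ha2, hah', hah, hag, hc⟩ :=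
    exists_involutions_of_isIcosahedral hM hI h2 hg hg3
  obtain ⟨A, rfl⟩ := proj_surjective g
  obtain ⟨H, rfl⟩ := proj_surjective h
  obtain ⟨B, rfl⟩ := proj_surjective a
  have hgt4 := hM _ hg hg1
  have hAs : ¬ IsScalar A := fun h => hg1 (proj_eq_one_iff.2 h)
  have hHA : H * A * H⁻¹ = A⁻¹ := conj_eq_inv h2 hAs (trsq_proj A ▸ hgt4) hhg hhg'
  obtain ⟨u, hu, huu, huH⟩ := exists_unit_of_conj_eq_inv h3 (trsq_proj A ▸ hgt) hHA
  have hHt : tr H = 0 := tr_eq_zero_of_conj_eq_inv hAs hHA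
  have hσA : projConjAut u (proj A) = proj A := by
    rw [projConjAut_proj, conjAut_eq_of_mul_eq (B := A)]
    rw [hu]
    simp [mul_sub, sub_mul]
  have hσH : projConjAut u (proj H) = proj H := by
    have hinv : (proj H : PSL₂)⁻¹ = proj H := inv_eq_of_mul_eq_one_left (by rw [← pow_two, hh2])
    rw [projConjAut_proj, conjAut_eq_of_mul_eq (B := H⁻¹), map_inv, hinv]
    rw [coe_inv_eq, hHt, zero_smul, zero_sub, neg_mul, huH, neg_neg]
  set b := projConjAut u (proj B) with hb
  have hbH : b * proj H * b⁻¹ = proj H := by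
    rw [← hσH, hb, ← map_inv, ← map_mul, ← map_mul, hah]
  have hbH' : b ∉ torus (proj H) := by
    rw [← hσH, hb, projConjAut_proj, projConjAut_proj, proj_mem_torus, ← map_mul, ← map_mul,
      (conjAut u).injective.eq_iff, ← proj_mem_torus]
    exact hah'
  refine ⟨proj H, ?_, orderOf_eq_prime hh2 hh1⟩
  have hht4 := hM _ hhM hh1
  have hσM : M.map (projConjAut u).toMonoidHom ≠ ⊤ := fun h =>
    hMtop (Subgroup.map_injective (projConjAut u).injective
      (h.trans (Subgroup.map_top_of_surjective _ (projConjAut u).surjective).symm))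
  refine isWitnessToFailure_of_maxIrredLen_eq_three hm (g := proj A) (a := proj B) (b := b) hh1 ?_
    (normalizer_torus_ne_top h2 hh1 hht4) hσM hMtop ?_ ?_ ⟨hg, haM, hhM⟩
  · by_contra hL
    have hsub : ({proj A, proj H, proj B} : Set PSL₂) ⊆ {proj A, proj B, b, proj H} := by
      intro x
      simp only [Set.mem_insert_iff, Set.mem_singleton_iff]
      tauto
    have hexotic : ∀ L : Subgroup PSL₂, L ≠ ⊤ → proj A ∈ L → proj H ∈ L → proj B ∈ L →
        Nat.card L = 24 ∨ Nat.card L = 60 := fun L hL h₁ h₂ h₃ =>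
      (isOctahedral_or_isIcosahedral h2 hL hg1 hgt4 hg3 hhg hhg'
        hag h₁ h₂ h₃).imp And.left And.left
    set L₀ := Subgroup.closure ({proj A, proj H, proj B} : Set PSL₂) with hL₀
    set L := Subgroup.closure ({proj A, proj B, b, proj H} : Set PSL₂) with hL'
    have hL₀M : L₀ ≤ M := by
      rw [hL₀, Subgroup.closure_le]
      rintro x (rfl | rfl | rfl) <;> assumption
    have hL₀L : L₀ ≤ L := Subgroup.closure_mono hsub
    have hgen : ∀ x ∈ ({proj A, proj H, proj B} : Set PSL₂), x ∈ L₀ :=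
      fun x hx => Subgroup.subset_closure hx
    have e₀ : L₀ = M := by
      refine Subgroup.eq_of_le_of_card_ge hL₀M ?_
      have hd := Subgroup.card_dvd_of_le hL₀M
      rw [hI.1] at hd ⊢
      rcases hexotic L₀ (fun h => hMtop (top_le_iff.1 (h ▸ hL₀M))) (hgen _ (by simp))
        (hgen _ (by simp)) (hgen _ (by simp)) with h | h <;> rw [h] at hd ⊢
      norm_num at hd
    have e₁ : M = L := by
      rw [← e₀]
      refine Subgroup.eq_of_le_of_card_ge hL₀L ?_
      rw [e₀, hI.1]
      rcases hexotic L hL (hL₀L (hgen _ (by simp))) (hL₀L (hgen _ (by simp)))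
        (hL₀L (hgen _ (by simp))) with h | h <;> rw [h]
      norm_num
    have hbM : b ∈ M := e₁ ▸ Subgroup.subset_closure (by simp)
    have hmem := mul_mem_torus h2 hh1 hht4 (by rw [hah]; exact self_mem_torus _)
      (by rw [hbH]; exact self_mem_torus _) hah' hbH'
    obtain ⟨k, hk⟩ := mem_zpowers_of_card_eq hhM (mul_mem haM hbM) hmem
      (hc.trans (orderOf_eq_prime hh2 hh1).symm)
    have hainv : (proj B : PSL₂)⁻¹ = proj B := inv_eq_of_mul_eq_one_left (by rw [← pow_two, ha2])
    have hk' : b = proj B * proj H ^ k := by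
      rw [← hainv, eq_inv_mul_iff_mul_eq]; exact hk.symm
    rcases Int.even_or_odd' k with ⟨l, rfl | rfl⟩
    · rw [_root_.zpow_mul, zpow_ofNat, hh2, _root_.one_zpow, mul_one] at hk'
      exact hag (conj_mem_torus_of_proj_conjAut_eq h2 hu hk')
    · rw [_root_.zpow_add, _root_.zpow_mul, zpow_ofNat, hh2, _root_.one_zpow,
          one_mul, zpow_one] at hk'
      refine four_mul_trsq_ne_one hp hI (y := proj (A * (B⁻¹ * A * B))) ?_
        (trsq_of_proj_conjAut_eq h2 (trsq_proj A ▸ hgt) hu huu huH hHt (by rw [map_mul]; exact hk'))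
      simp only [map_mul, map_inv]
      exact mul_mem hg (mul_mem (mul_mem (inv_mem haM) hg) haM)
  · exact ⟨(mem_normalizer_torus hh1).2 (hah.symm ▸ self_mem_torus _),
      (mem_normalizer_torus hh1).2 (hbH.symm ▸ self_mem_torus _),
      torus_le_normalizer _ (self_mem_torus _)⟩
  · exact ⟨⟨_, hg, hσA⟩, ⟨_, haM, rfl⟩, ⟨_, hhM, hσH⟩⟩

end SLTwo

end

section
open Matrix

theorem Fin.exists_notMem_of_card_lt {n : ℕ} (t : Finset (Fin n)) (h : t.card < n) :
    ∃ i, i ∉ t := by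
  by_contra! hcon
  have : t = Finset.univ := Finset.eq_univ_of_forall hcon
  simp [this] at h

theorem IsWitnessToFailure.of_mem_zpowers {G : Type*} [Group G] {x y : G}
    (hx : IsWitnessToFailure x) (hy : y ∈ Subgroup.zpowers x) (hy1 : y ≠ 1) :
    IsWitnessToFailure y := by
  obtain ⟨-, s, hs, hs', hsx⟩ := hx
  refine ⟨hy1, s, hs, hs', fun i => not_isGenSeq_of_forall_mem (hsx i) fun j => ?_⟩
  have hmem : ∀ j, Function.update s i x j ∈ Subgroup.closure (Set.range (Function.update s i x)) :=
    fun j => Subgroup.subset_closure ⟨j, rfl⟩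
  by_cases hj : j = i
  · subst hj
    have := hmem j
    rw [Function.update_self] at this ⊢
    exact (Subgroup.zpowers_le.2 this) hy
  · have := hmem j
    rwa [Function.update_of_ne hj] at this ⊢

namespace SLTwo

variable {p : ℕ} [Fact p.Prime]

local notation "PSL₂" => Matrix.ProjectiveSpecialLinearGroup (Fin 2) (ZMod p)

theorem isSimpleGroup_projectiveSpecialLinearGroup (hp : 5 < p) : IsSimpleGroup PSL₂ :=
  Matrix.ProjectiveSpecialLinearGroup.rank_two_simple (by rw [Nat.card_zmod]; omega)

theorem exists_sq_eq_one (F : Type*) [Field F] :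
    ∃ x : Matrix.ProjectiveSpecialLinearGroup (Fin 2) F, x ≠ 1 ∧ x ^ 2 = 1 := by
  obtain ⟨S, h00, h01, h10, h11⟩ : ∃ S : Matrix.SpecialLinearGroup (Fin 2) F,
      S 0 0 = 0 ∧ S 0 1 = 1 ∧ S 1 0 = -1 ∧ S 1 1 = 0 :=
    ⟨⟨!![0, 1; -1, 0], by simp⟩, rfl, rfl, rfl, rfl⟩
  refine ⟨proj S, ?_, ?_⟩
  · rw [Ne, proj_eq_one_iff]
    simp [IsScalar, h01]
  · rw [← map_pow, proj_eq_one_iff, pow_two]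
    simp [IsScalar, mul_00, mul_01, mul_10, mul_11, h00, h01, h10, h11]

theorem exists_mul_ne_mul {F : Type*} [Field F] (h2 : (2 : F) ≠ 0) :
    ∃ a b : Matrix.ProjectiveSpecialLinearGroup (Fin 2) F, a * b ≠ b * a := by
  by_contra! hcomm
  obtain ⟨x, hx1, hx2⟩ := exists_sq_eq_one F
  have ht : trsq x ≠ 4 := by
    rw [trsq_of_sq_eq_one hx1 hx2, show (4 : F) = 2 * 2 by norm_num]
    exact (mul_ne_zero h2 h2).symm
  refine normalizer_torus_ne_top h2 hx1 ht (top_le_iff.1 fun y _ => ?_)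
  rw [mem_normalizer_torus hx1, hcomm y x, mul_inv_cancel_right]
  exact self_mem_torus x

theorem trsq_ne_four_of_sup_eq_top (h2 : (2 : ZMod p) ≠ 0) {K L : Subgroup PSL₂} (hK : K ≠ ⊤)
    (hL : L ≠ ⊤) (hKL : K ⊔ L = ⊤) {g : PSL₂} (hg : g ∈ K ⊓ L) (hg1 : g ≠ 1) : trsq g ≠ 4 := by
  intro ht
  obtain ⟨v, hv, hKv⟩ := (eq_top_or_exists_le_lineStab h2 hg.1 hg1 ht).resolve_left hK
  obtain ⟨w, hw, hLw⟩ := (eq_top_or_exists_le_lineStab h2 hg.2 hg1 ht).resolve_left hL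
  have hvw := parallel_of_trsq_eq_four h2 hv hw hg1 ht (hKv hg.1) (hLw hg.2)
  exact lineStab_ne_top hw (top_le_iff.1
    (hKL ▸ sup_le (hKv.trans (lineStab_le_of_parallel hv hvw)) hLw))

theorem inf_le_normalizer_torus_or_isPolyhedral (h2 : (2 : ZMod p) ≠ 0) {K L : Subgroup PSL₂}
    (hK : K ≠ ⊤) (hL : L ≠ ⊤) (hKL : K ⊔ L = ⊤) {g : PSL₂} (hg : g ∈ K ⊓ L) (hg1 : g ≠ 1)
    (hg2 : g ^ 2 ≠ 1) : K ⊓ L ≤ Subgroup.normalizer (torus g : Set PSL₂) ∨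
      IsRegular K ∧ IsRegular L ∧ IsPolyhedral K ∧ IsPolyhedral L ∧ IsPolyhedral (K ⊓ L) := by
  have hreg : ∀ K L : Subgroup PSL₂, IsRegular K → g ∈ K ⊓ L → (∃ v, v ≠ 0 ∧ L ≤ lineStab v) →
      K ⊓ L ≤ Subgroup.normalizer (torus g : Set PSL₂) := by
    rintro K L hK hg ⟨v, hv, hL⟩ y hy
    exact torus_le_normalizer g ((hK.mono inf_le_left).mem_torus_of_le_lineStab h2 hv
      (inf_le_right.trans hL) hg hy)
  rcases isRegular_or_le_lineStab h2 hK with hKr | ⟨v, hv, hKv⟩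
  · rcases isRegular_or_le_lineStab h2 hL with hLr | hL'
    · rcases hKr.le_normalizer_torus_or_isPolyhedral h2 hg.1 hg1 hg2 with h | hKp
      · exact .inl (inf_le_left.trans h)
      rcases hLr.le_normalizer_torus_or_isPolyhedral h2 hg.2 hg1 hg2 with h | hLp
      · exact .inl (inf_le_right.trans h)
      exact ((hKr.mono inf_le_left).le_normalizer_torus_or_isPolyhedral h2 hg hg1 hg2).imp_right
        fun h => ⟨hKr, hLr, hKp, hLp, h⟩
    · exact .inl (hreg K L hKr hg hL')
  · rcases isRegular_or_le_lineStab h2 hL with hLr | ⟨w, hw, hLw⟩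
    · exact .inl (inf_comm K L ▸ hreg L K hLr hg.symm ⟨v, hv, hKv⟩)
    · refine .inl ((inf_le_inf hKv hLw).trans ((lineStab_inf_le_torus (fun hvw => ?_)
        ⟨hKv hg.1, hLw hg.2⟩).trans (torus_le_normalizer g)))
      exact lineStab_ne_top hw (top_le_iff.1
        (hKL ▸ sup_le (hKv.trans (lineStab_le_of_parallel hv hvw)) hLw))

theorem _root_.Subgroup.le_normalizer_of_card_eq_two_mul {G : Type*} [Group G] [Finite G]
    {H K : Subgroup G} (hHK : H ≤ K) (h : Nat.card K = 2 * Nat.card H) :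
    K ≤ Subgroup.normalizer (H : Set G) := by
  rw [← Subgroup.normal_subgroupOf_iff_le_normalizer hHK]
  refine Subgroup.normal_of_index_eq_two ?_
  have := (H.subgroupOf K).index_mul_card
  rw [Nat.card_congr (Subgroup.subgroupOfEquivOfLe hHK).toEquiv, h] at this
  exact Nat.eq_of_mul_eq_mul_right Nat.card_pos this

/-- If two proper polyhedral subgroups generate the group and their intersection is polyhedral,
then the intersection is tetrahedral and one of them is icosahedral. -/
theorem card_eq_of_isPolyhedral (hp : 5 < p) {K L : Subgroup PSL₂} (hK : IsPolyhedral K)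
    (hL : IsPolyhedral L) (hA : IsPolyhedral (K ⊓ L)) (hKL : K ⊔ L = ⊤) (hKL' : ¬ K ≤ L)
    (hLK : ¬ L ≤ K) :
    Nat.card (K ⊓ L : Subgroup PSL₂) = 12 ∧ (Nat.card K = 60 ∨ Nat.card L = 60) := by
  have hlt : ∀ H : Subgroup PSL₂, K ⊓ L ≤ H → ¬ H ≤ K ⊓ L →
      Nat.card (K ⊓ L : Subgroup PSL₂) ∣ Nat.card H ∧
        Nat.card (K ⊓ L : Subgroup PSL₂) ≠ Nat.card H := fun H h h' =>
    ⟨Subgroup.card_dvd_of_le h, fun hc => h' (Subgroup.eq_of_le_of_card_ge h hc.ge).ge⟩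
  obtain ⟨hdK, hnK⟩ := hlt K inf_le_left fun h => hKL' (h.trans inf_le_right)
  obtain ⟨hdL, hnL⟩ := hlt L inf_le_right fun h => hLK (h.trans inf_le_left)
  have h24 : ¬ (Nat.card (K ⊓ L : Subgroup PSL₂) = 12 ∧ Nat.card K = 24 ∧ Nat.card L = 24) := by
    rintro ⟨hA', hK', hL'⟩
    have := isSimpleGroup_projectiveSpecialLinearGroup hp
    have hn : Subgroup.normalizer ((K ⊓ L : Subgroup PSL₂) : Set PSL₂) = ⊤ := by
      rw [eq_top_iff, ← hKL]
      exact sup_le (Subgroup.le_normalizer_of_card_eq_two_mul inf_le_left (by rw [hA', hK']))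
        (Subgroup.le_normalizer_of_card_eq_two_mul inf_le_right (by rw [hA', hL']))
    rcases (Subgroup.normalizer_eq_top_iff.1 hn).eq_bot_or_eq_top with h | h
    · rw [h, Subgroup.card_bot] at hA'
      omega
    · exact hKL' (le_top.trans (h.ge.trans inf_le_right))
  have hAc := hA.card
  have hKc := hK.card
  have hLc := hL.card
  revert hdK hnK hdL hnL h24 hAc hKc hLc
  generalize Nat.card (K ⊓ L : Subgroup PSL₂) = a
  generalize Nat.card K = b
  generalize Nat.card L = c
  rintro hdK hnK hdL hnL h24 (rfl | rfl | rfl) (rfl | rfl | rfl) (rfl | rfl | rfl) <;> omega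

end SLTwo

end

section
open Matrix

theorem IsWitnessToFailure.exists_subgroups {G : Type*} [Group G] {x : G}
    (hx : IsWitnessToFailure x) :
    ∃ (s : Fin (maxIrredLen G) → G) (M : Fin (maxIrredLen G) → Subgroup G), IsGenSeq s ∧
      (∀ i, M i ≠ ⊤) ∧ (∀ i, x ∈ M i) ∧ (∀ i j, j ≠ i → s j ∈ M i) ∧ (∀ i, s i ∉ M i) ∧
      ∀ i j, i ≠ j → M i ⊔ M j = ⊤ := by
  obtain ⟨-, s, hs, -, hsx⟩ := hx
  have hmem : ∀ i j, j ≠ i →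
      s j ∈ Subgroup.closure (Set.range (Function.update s i x)) := fun i j hj =>
    Subgroup.subset_closure ⟨j, Function.update_of_ne hj _ _⟩
  refine ⟨s, fun i => Subgroup.closure (Set.range (Function.update s i x)), hs, hsx,
    fun i => Subgroup.subset_closure ⟨i, Function.update_self _ _ _⟩, hmem, fun i hi => ?_,
    fun i j hij => ?_⟩
  · refine not_isGenSeq_of_forall_mem (hsx i) (fun j => ?_) hs
    rcases eq_or_ne j i with rfl | hj
    exacts [hi, hmem i j hj]
  · by_contra hne
    refine not_isGenSeq_of_forall_mem hne (fun k => ?_) hs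
    rcases eq_or_ne k i with rfl | hk
    exacts [Subgroup.mem_sup_right (hmem j k hij), Subgroup.mem_sup_left (hmem i k hk)]

theorem mem_of_inf_le {G : Type*} [Group G] {n : ℕ} (hn : 3 ≤ n) {s : Fin n → G}
    {M : Fin n → Subgroup G} {D : Subgroup G} (hsM : ∀ i j, j ≠ i → s j ∈ M i)
    (h : ∀ i j, i ≠ j → M i ⊓ M j ≤ D) (k : Fin n) : s k ∈ D := by
  obtain ⟨i, hi⟩ := Fin.exists_notMem_of_card_lt {k} (by simp; omega)
  obtain ⟨j, hj⟩ := Fin.exists_notMem_of_card_lt {k, i}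
    (Finset.card_le_two.trans_lt (by omega))
  simp only [Finset.mem_singleton, Finset.mem_insert, not_or] at hi hj
  exact h i j (Ne.symm hj.2) ⟨hsM i k (Ne.symm hi), hsM j k (Ne.symm hj.1)⟩

namespace SLTwo

variable {p : ℕ} [Fact p.Prime]

local notation "PSL₂" => Matrix.ProjectiveSpecialLinearGroup (Fin 2) (ZMod p)

theorem IsPolyhedral.isTetrahedral_of_card {F : Type*} [Field F]
    {K : Subgroup (Matrix.ProjectiveSpecialLinearGroup (Fin 2) F)} (hK : IsPolyhedral K)
    (h : Nat.card K = 12) : IsToralPartition.IsTetrahedral (subTorus K) := by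
  rcases hK with hK | hK | hK
  · exact hK
  · exact absurd (h.symm.trans hK.1) (by norm_num)
  · exact absurd (h.symm.trans hK.1) (by norm_num)

theorem IsPolyhedral.isIcosahedral_of_card {F : Type*} [Field F]
    {K : Subgroup (Matrix.ProjectiveSpecialLinearGroup (Fin 2) F)} (hK : IsPolyhedral K)
    (h : Nat.card K = 60) : IsToralPartition.IsIcosahedral (subTorus K) := by
  rcases hK with hK | hK | hK
  · exact absurd (h.symm.trans hK.1) (by norm_num)
  · exact absurd (h.symm.trans hK.1) (by norm_num)
  · exact hK

theorem IsPolyhedral.twelve_le_card {F : Type*} [Field F]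
    {K : Subgroup (Matrix.ProjectiveSpecialLinearGroup (Fin 2) F)} (hK : IsPolyhedral K) :
    12 ≤ Nat.card K := by
  rcases hK.card with h | h | h <;> rw [h] <;> norm_num

/-- An element of odd order in a tetrahedral group has order three, and generates its own torus,
which is self-normalizing. -/
theorem orderOf_eq_three_of_isTetrahedral {F : Type*} [Field F]
    {K : Subgroup (Matrix.ProjectiveSpecialLinearGroup (Fin 2) F)}
    (hK : IsToralPartition.IsTetrahedral (subTorus K))
    {g : Matrix.ProjectiveSpecialLinearGroup (Fin 2) F} (hg : g ∈ K) (hg1 : g ≠ 1)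
    (hodd : ¬ 2 ∣ orderOf g) : orderOf g = 3 ∧ Nat.card (subTorus K ⟨g, hg⟩) = 3 ∧
      Nat.card (Subgroup.normalizer (subTorus K ⟨g, hg⟩ : Set K)) = 3 := by
  have hd := orderOf_dvd_card_subTorus hg hg (self_mem_torus g)
  have h1 : orderOf g ≠ 1 := fun h => hg1 (orderOf_eq_one_iff.1 h)
  rcases hK.2 ⟨g, hg⟩ (by simpa [Subtype.ext_iff] using hg1) with ⟨h, -⟩ | ⟨h, h'⟩
  · rw [h, Nat.dvd_prime Nat.prime_two] at hd
    exact absurd (hd.resolve_left h1).symm.dvd hodd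
  · rw [h, Nat.dvd_prime Nat.prime_three] at hd
    exact ⟨hd.resolve_left h1, h, h'⟩

/-- A tetrahedral intersection of two of the subgroups attached to a witness to failure of odd
order forces the generating sequence to have length three. -/
theorem le_three_of_isTetrahedral (h2 : (2 : ZMod p) ≠ 0) {n : ℕ} {s : Fin n → PSL₂}
    {M : Fin n → Subgroup PSL₂} {g : PSL₂} (hg1 : g ≠ 1) (hodd : ¬ 2 ∣ orderOf g)
    (hgM : ∀ i, g ∈ M i) (hsM : ∀ i j, j ≠ i → s j ∈ M i) (hsM' : ∀ i, s i ∉ M i) {i j : Fin n}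
    (hreg : IsRegular (M i ⊓ M j))
    (hA : IsToralPartition.IsTetrahedral (subTorus (M i ⊓ M j))) : n ≤ 3 := by
  by_contra! hn
  obtain ⟨k, hk⟩ := Fin.exists_notMem_of_card_lt {i, j} (Finset.card_le_two.trans_lt (by omega))
  obtain ⟨l, hl⟩ := Fin.exists_notMem_of_card_lt {i, j, k} (Finset.card_le_three.trans_lt hn)
  simp only [Finset.mem_singleton, Finset.mem_insert, not_or] at hk hl
  have hgA : g ∈ M i ⊓ M j := ⟨hgM i, hgM j⟩
  have hlA : s l ∈ M i ⊓ M j := ⟨hsM i l hl.1, hsM j l hl.2.1⟩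
  obtain ⟨ho, hT, hN⟩ := orderOf_eq_three_of_isTetrahedral hA hgA hg1 hodd
  have hg2 : g ^ 2 ≠ 1 := fun h => by
    have := orderOf_dvd_of_pow_eq_one h
    rw [ho] at this
    norm_num at this
  have hle : M i ⊓ M j ⊓ M k ≤ Subgroup.normalizer (torus g : Set PSL₂) := by
    refine ((hreg.mono inf_le_left).le_normalizer_torus_or_isPolyhedral h2 ⟨hgA, hgM k⟩ hg1
      hg2).resolve_right fun hP => hsM' k ?_
    have he : M i ⊓ M j ⊓ M k = M i ⊓ M j :=
      Subgroup.eq_of_le_of_card_ge inf_le_left (hA.1.trans_le hP.twelve_le_card)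
    exact (he.ge.trans inf_le_right) ⟨hsM i k hk.1, hsM j k hk.2⟩
  have hmem := (mem_normalizer_torus hg1).1 (hle ⟨hlA, hsM k l hl.2.2⟩)
  have hlT : s l ∈ torus g := hreg.mem_torus_of_card_eq h2 (x := ⟨g, hgA⟩)
    (by simpa [Subtype.ext_iff] using hg1) (hN.trans hT.symm) hlA hmem
  exact hsM' l ((Subgroup.zpowers_le.2 (hgM l))
    (mem_zpowers_of_card_eq hgA hlA hlT (hT.trans ho.symm)))

theorem exists_witness_of_odd (hp : 5 < p) {g : PSL₂} (hg : IsWitnessToFailure g)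
    (hodd : ¬ 2 ∣ orderOf g) : ∃ x : PSL₂, IsWitnessToFailure x ∧ orderOf x = 2 := by
  obtain ⟨h2, -, -⟩ := two_three_five_ne_zero hp
  have hg1 := hg.1
  have hg2 : g ^ 2 ≠ 1 := fun h => by
    rcases (Nat.dvd_prime Nat.prime_two).1 (orderOf_dvd_of_pow_eq_one h) with h | h
    · exact hg1 (orderOf_eq_one_iff.1 h)
    · exact hodd h.symm.dvd
  have := isSimpleGroup_projectiveSpecialLinearGroup hp
  have hm : 3 ≤ maxIrredLen PSL₂ := three_le_maxIrredLen (exists_mul_ne_mul h2) (exists_sq_eq_one _)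
  obtain ⟨s, M, hs, hM, hgM, hsM, hsM', hsup⟩ := hg.exists_subgroups
  have ht : trsq g ≠ 4 := trsq_ne_four_of_sup_eq_top h2 (hM ⟨0, by omega⟩) (hM ⟨1, by omega⟩)
    (hsup _ _ (by simp)) ⟨hgM _, hgM _⟩ hg1
  obtain ⟨i, j, hij, hMij⟩ : ∃ i j, i ≠ j ∧
      ¬ M i ⊓ M j ≤ Subgroup.normalizer (torus g : Set PSL₂) := by
    by_contra! hcon
    exact not_isGenSeq_of_forall_mem (normalizer_torus_ne_top h2 hg1 ht)
      (mem_of_inf_le hm hsM hcon) hs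
  obtain ⟨hri, hrj, hPi, hPj, hPA⟩ := (inf_le_normalizer_torus_or_isPolyhedral h2 (hM i) (hM j)
    (hsup i j hij) ⟨hgM i, hgM j⟩ hg1 hg2).resolve_left hMij
  obtain ⟨hA, hc⟩ := card_eq_of_isPolyhedral hp hPi hPj hPA (hsup i j hij)
    (fun h => hsM' j (h (hsM i j hij.symm))) fun h => hsM' i (h (hsM j i hij))
  have hT := hPA.isTetrahedral_of_card hA
  have hm3 : maxIrredLen PSL₂ = 3 := le_antisymm
    (le_three_of_isTetrahedral h2 hg1 hodd hgM hsM hsM' (hri.mono inf_le_left) hT) hm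
  obtain ⟨ho, -, -⟩ := orderOf_eq_three_of_isTetrahedral hT ⟨hgM i, hgM j⟩ hg1 hodd
  rcases hc with hc | hc
  · exact exists_witness_of_isIcosahedral hp hm3 (hM i) hri (hPi.isIcosahedral_of_card hc)
      (hgM i) ho
  · exact exists_witness_of_isIcosahedral hp hm3 (hM j) hrj (hPj.isIcosahedral_of_card hc)
      (hgM j) ho

end SLTwo

end

theorem psl_witness_of_order_two_of_not_rp (p : ℕ) [Fact p.Prime] (hp : 5 < p)
    (h : ¬ ReplacementProperty (PSL p)) :
    ∃ g : PSL p, IsWitnessToFailure g ∧ orderOf g = 2 := by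
  unfold ReplacementProperty at h
  push Not at h
  obtain ⟨s, hs, hs', x, hx1, hx⟩ := h
  have hxw : IsWitnessToFailure x := ⟨hx1, s, hs, hs', hx⟩
  by_cases heven : 2 ∣ orderOf x
  · have ho : orderOf (x ^ (orderOf x / 2)) = 2 :=
      orderOf_pow_orderOf_div (orderOf_pos x).ne' heven
    refine ⟨_, hxw.of_mem_zpowers (Subgroup.pow_mem _ (Subgroup.mem_zpowers x) _) fun h1 => ?_, ho⟩
    rw [h1, orderOf_one] at ho
    omega
  · exact SLTwo.exists_witness_of_odd hp hxw heven
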